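/- arXiv:1404.6202 — 4 statements merged into one kernel-verified Lean document; each statement's English description precedes it below -/
import Mathlib

section
/- Nonnegativity of the polarized Hessian form: let A_1,…,A_m be n×n complex Hermitian matrices with σ_k(A_j) ≥ 0 for every k = 1,…,m and every j = 1,…,m. Then D_m(A_1,…,A_m) ≥ 0. -/
/-- `σ_k(A)`: the `k`-th elementary symmetric polynomial of the real eigenvalues
(with multiplicity) of the Hermitian matrix `A` (with `σ_0 = 1`). -/
noncomputable def sigmaH {n : ℕ} {A : Matrix (Fin n) (Fin n) ℂ}
    (hA : A.IsHermitian) (k : ℕ) : ℝ :=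
  ∑ S ∈ Finset.powersetCard k (Finset.univ : Finset (Fin n)), ∏ i ∈ S, hA.eigenvalues i

theorem isHermitian_finsetSum {n : ℕ} {ι : Type*} (A : ι → Matrix (Fin n) (Fin n) ℂ)
    (hA : ∀ j, (A j).IsHermitian) (T : Finset ι) : (∑ j ∈ T, A j).IsHermitian := by
  unfold Matrix.IsHermitian
  rw [Matrix.conjTranspose_sum]
  exact Finset.sum_congr rfl fun j _ => hA j

/-- The polarized `m`-th Hessian form
`D_m(A₁,…,A_m) = (1/m!) ∑_{∅ ≠ T ⊆ {1,…,m}} (−1)^{m−|T|} σ_m(∑_{j∈T} A_j)`. -/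
noncomputable def Dpol {n m : ℕ} (A : Fin m → Matrix (Fin n) (Fin n) ℂ)
    (hA : ∀ j, (A j).IsHermitian) : ℝ :=
  (m.factorial : ℝ)⁻¹ *
    ∑ T ∈ (Finset.univ : Finset (Finset (Fin m))).filter (fun T => T ≠ ∅),
      (-1 : ℝ) ^ (m - T.card) * sigmaH (isHermitian_finsetSum A hA T) m


namespace Hess

set_option linter.unusedSectionVars false

open Polynomial

variable {ι : Type*} [Fintype ι]

/-- restriction of `p` to the affine line `z + s a` -/
noncomputable def line {K : Type*} [CommRing K] [Algebra ℝ K] (z : ι → K) (a : ι → ℝ) :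
    MvPolynomial ι ℝ →ₐ[ℝ] K[X] :=
  MvPolynomial.aeval (fun i => C (z i) + C (algebraMap ℝ K (a i)) * X)

/-- directional derivative -/
noncomputable def dirD (a : ι → ℝ) : Derivation ℝ (MvPolynomial ι ℝ) (MvPolynomial ι ℝ) :=
  MvPolynomial.mkDerivation ℝ (fun i => MvPolynomial.C (a i))

theorem dirD_eq (a : ι → ℝ) (p : MvPolynomial ι ℝ) :
    dirD a p = ∑ i, MvPolynomial.C (a i) * MvPolynomial.pderiv i p := by
  classical
  have hs : ∀ q, (∑ i, (MvPolynomial.C (a i) : MvPolynomial ι ℝ) •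
      (MvPolynomial.pderiv i : Derivation ℝ (MvPolynomial ι ℝ) (MvPolynomial ι ℝ))) q =
      ∑ i, MvPolynomial.C (a i) * MvPolynomial.pderiv i q := by
    intro q
    have := congrFun (map_sum (Derivation.coeFnAddMonoidHom (R := ℝ) (A := MvPolynomial ι ℝ)
      (M := MvPolynomial ι ℝ)) (fun i => (MvPolynomial.C (a i) : MvPolynomial ι ℝ) •
      (MvPolynomial.pderiv i : Derivation ℝ (MvPolynomial ι ℝ) (MvPolynomial ι ℝ)))
      Finset.univ) q
    rw [Finset.sum_apply] at this
    exact this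
  have : dirD a = ∑ i, (MvPolynomial.C (a i) : MvPolynomial ι ℝ) •
      (MvPolynomial.pderiv i : Derivation ℝ (MvPolynomial ι ℝ) (MvPolynomial ι ℝ)) := by
    apply MvPolynomial.derivation_ext
    intro j
    rw [dirD, MvPolynomial.mkDerivation_X, hs]
    simp [MvPolynomial.pderiv_X, Pi.single_apply]
  rw [this, hs]

theorem dirD_hom {d : ℕ} (a : ι → ℝ) {p : MvPolynomial ι ℝ} (hp : p.IsHomogeneous d) :
    (dirD a p).IsHomogeneous (d - 1) := by
  rw [dirD_eq]
  exact MvPolynomial.IsHomogeneous.sum _ _ _ fun i _ => (hp.pderiv).C_mul _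

theorem derivative_line {K : Type*} [CommRing K] [Algebra ℝ K] (z : ι → K) (a : ι → ℝ)
    (p : MvPolynomial ι ℝ) : derivative (line z a p) = line z a (dirD a p) := by
  induction p using MvPolynomial.induction_on with
  | C r => simp [line, dirD, MvPolynomial.derivation_C, Polynomial.algebraMap_apply]
  | add p q hp hq => simp [hp, hq]
  | mul_X p i hp =>
    rw [map_mul, derivative_mul, hp, Derivation.leibniz]
    simp [line, dirD, MvPolynomial.mkDerivation_X, Polynomial.algebraMap_apply]
    ring

theorem iter_derivative_line {K : Type*} [CommRing K] [Algebra ℝ K] (z : ι → K) (a : ι → ℝ)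
    (k : ℕ) (p : MvPolynomial ι ℝ) :
    derivative^[k] (line z a p) = line z a ((dirD a)^[k] p) := by
  induction k generalizing p with
  | zero => rfl
  | succ k ih => rw [Function.iterate_succ_apply, Function.iterate_succ_apply, derivative_line, ih]

theorem eval_line {K : Type*} [CommRing K] [Algebra ℝ K] (z : ι → K) (a : ι → ℝ) (s : K)
    (p : MvPolynomial ι ℝ) :
    (line z a p).eval s = MvPolynomial.aeval (fun i => z i + algebraMap ℝ K (a i) * s) p := by
  induction p using MvPolynomial.induction_on with
  | C r => simp [line, Polynomial.algebraMap_apply]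
  | add p q hp hq => simp [hp, hq]
  | mul_X p i hp =>
    rw [map_mul, eval_mul, hp]
    simp [line]

theorem aeval_smul_hom {K : Type*} [CommRing K] [Algebra ℝ K] {d : ℕ}
    {p : MvPolynomial ι ℝ} (hp : p.IsHomogeneous d) (c : K) (z : ι → K) :
    MvPolynomial.aeval (fun i => c * z i) p = c ^ d * MvPolynomial.aeval z p := by
  simp only [MvPolynomial.aeval_def, MvPolynomial.eval₂_eq', Finset.mul_sum]
  refine Finset.sum_congr rfl fun s hs => ?_
  have h := hp.degree_eq_sum_deg_support hs
  simp only [mul_pow, Finset.prod_mul_distrib, Finset.prod_pow_eq_pow_sum]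
  have h2 : ∑ i, s i = d := by
    rw [h]
    exact (Finset.sum_subset (Finset.subset_univ _) (by simp)).symm
  rw [h2]; ring

theorem line_deg {d : ℕ} {p : MvPolynomial ι ℝ} (hp : p.IsHomogeneous d)
    (z : ι → ℂ) (a : ι → ℝ) :
    (line z a p).natDegree ≤ d ∧
      (line z a p).coeff d = ((MvPolynomial.aeval a p : ℝ) : ℂ) := by
  classical
  have key : ∀ (S : Finset ι) (s : ι → ℕ),
      (∏ i ∈ S, (C (z i) + C ((a i : ℂ)) * X) ^ s i).natDegree ≤ ∑ i ∈ S, s i ∧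
      (∏ i ∈ S, (C (z i) + C ((a i : ℂ)) * X) ^ s i).coeff (∑ i ∈ S, s i) =
        ∏ i ∈ S, (a i : ℂ) ^ s i := by
    intro S s
    have h1 : ∀ i, (C (z i) + C ((a i : ℂ)) * X).natDegree ≤ 1 := by
      intro i
      rw [add_comm]
      exact natDegree_linear_le
    have h2 : ∀ i, ((C (z i) + C ((a i : ℂ)) * X) ^ s i).natDegree ≤ s i := fun i => by
      simpa using natDegree_pow_le_of_le (s i) (h1 i)
    have h3 : ∀ i, ((C (z i) + C ((a i : ℂ)) * X) ^ s i).coeff (s i) = (a i : ℂ) ^ s i := fun i => by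
      have := coeff_pow_of_natDegree_le (m := s i) (h1 i)
      rw [mul_one] at this
      rw [this]; simp
    induction S using Finset.induction_on with
    | empty => simp
    | insert i S hi ih =>
      rw [Finset.prod_insert hi, Finset.sum_insert hi, Finset.prod_insert hi]
      exact ⟨natDegree_mul_le_of_le (h2 i) ih.1, by
        rw [coeff_mul_add_eq_of_natDegree_le (h2 i) ih.1, h3, ih.2]⟩
  have hs2 : ∀ s ∈ p.support, ∑ i, s i = d := fun s hs => by
    rw [hp.degree_eq_sum_deg_support hs]
    exact (Finset.sum_subset (Finset.subset_univ _) (by simp)).symm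
  constructor
  · simp only [line, MvPolynomial.aeval_def, MvPolynomial.eval₂_eq']
    refine natDegree_sum_le_of_forall_le _ _ fun s hs => ?_
    rw [Polynomial.algebraMap_apply]
    refine (natDegree_C_mul_le _ _).trans ?_
    have := (key Finset.univ s).1
    rw [hs2 s hs] at this
    exact this
  · simp only [line, MvPolynomial.aeval_def, MvPolynomial.eval₂_eq', finsetSum_coeff]
    push_cast
    refine Finset.sum_congr rfl fun s hs => ?_
    rw [Polynomial.algebraMap_apply, coeff_C_mul]
    have := (key Finset.univ s).2
    rw [hs2 s hs] at this
    simp only [Complex.coe_algebraMap] at this ⊢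
    rw [this]
    simp

/-- the complex point `x + i y` -/
noncomputable def cpt (x y : ι → ℝ) : ι → ℂ := fun i => (x i : ℂ) + Complex.I * (y i : ℂ)

/-- hyperbolicity directions -/
def H (p : MvPolynomial ι ℝ) : Set (ι → ℝ) :=
  {y | ∀ x : ι → ℝ, MvPolynomial.aeval (cpt x y) p ≠ 0}

theorem aeval_ofReal (p : MvPolynomial ι ℝ) (x : ι → ℝ) :
    MvPolynomial.aeval (fun i => (x i : ℂ)) p = ((MvPolynomial.aeval x p : ℝ) : ℂ) := by
  have := MvPolynomial.aeval_algebraMap_apply ℂ x p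
  exact this

theorem H_smul {d : ℕ} {p : MvPolynomial ι ℝ} (hp : p.IsHomogeneous d) {y : ι → ℝ}
    (hy : y ∈ H p) {t : ℝ} (ht : t ≠ 0) : t • y ∈ H p := by
  intro x h
  apply hy (t⁻¹ • x)
  have : cpt x (t • y) = fun i => (t : ℂ) * cpt (t⁻¹ • x) y i := by
    funext i
    have : (t : ℂ) ≠ 0 := by exact_mod_cast ht
    simp only [cpt, Pi.smul_apply, smul_eq_mul]
    push_cast
    field_simp
  rw [this, aeval_smul_hom hp] at h
  have h0 : (t : ℂ) ^ d ≠ 0 := pow_ne_zero _ (by exact_mod_cast ht)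
  exact (mul_eq_zero.mp h).resolve_left h0

theorem H_ne {d : ℕ} {p : MvPolynomial ι ℝ} (hp : p.IsHomogeneous d) {y : ι → ℝ}
    (hy : y ∈ H p) : MvPolynomial.aeval y p ≠ (0 : ℝ) := by
  intro h
  apply hy 0
  have : cpt 0 y = fun i => Complex.I * ((y i : ℂ)) := by
    funext i; simp [cpt]
  rw [this, aeval_smul_hom hp, aeval_ofReal, h]
  simp

theorem cont_aeval {X K : Type*} [TopologicalSpace X] [CommRing K] [Algebra ℝ K]
    [TopologicalSpace K] [IsTopologicalRing K] (p : MvPolynomial ι ℝ)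
    {f : X → ι → K} (hf : Continuous f) :
    Continuous fun x => MvPolynomial.aeval (f x) p := by
  simp only [MvPolynomial.aeval_def, MvPolynomial.eval₂_eq']
  have : ∀ i, Continuous fun x => f x i := fun i => (continuous_apply i).comp hf
  fun_prop

/-- Lemma G: derivative along a cone direction preserves stability. -/
theorem H_dirD {d : ℕ} (hd : 1 ≤ d) {p : MvPolynomial ι ℝ} (hp : p.IsHomogeneous d)
    (Cc : ConvexCone ℝ (ι → ℝ)) (hC : (Cc : Set (ι → ℝ)) ⊆ H p) {a : ι → ℝ} (ha : a ∈ Cc) :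
    (Cc : Set (ι → ℝ)) ⊆ H (dirD a p) := by
  intro y hy x h
  set f := line (cpt x y) a p with hf
  have hroot : ∀ s : ℂ, 0 ≤ s.im → f.eval s ≠ 0 := by
    intro s hs h0
    have hmem : y + s.im • a ∈ Cc := by
      rcases hs.eq_or_lt with h1 | h1
      · rw [← h1]; simpa using hy
      · exact Cc.add_mem hy (Cc.smul_mem h1 ha)
    apply hC hmem (x + s.re • a)
    rw [hf, eval_line] at h0
    rw [← h0]
    congr 2
    funext i
    simp only [cpt, Pi.add_apply, Pi.smul_apply, smul_eq_mul, Complex.coe_algebraMap]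
    push_cast
    conv_rhs => rw [← Complex.re_add_im s]
    ring
  have hdeg := line_deg hp (cpt x y) a
  have hcoef : f.coeff d ≠ 0 := by
    rw [hf, hdeg.2]
    exact_mod_cast H_ne hp (hC ha)
  have hnd : 0 < f.natDegree := lt_of_lt_of_le hd (le_natDegree_of_ne_zero hcoef)
  have hf0 : f ≠ 0 := by rintro h; rw [h] at hcoef; simp at hcoef
  have hspl : f.Splits := IsAlgClosed.splits f
  have hd0 : (derivative f).eval 0 = 0 := by
    rw [hf, derivative_line, eval_line]; simpa using h
  have hsum := hspl.eval_derivative_div_eval_of_ne_zero (hroot 0 (by simp))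
  rw [hd0, zero_div] at hsum
  have him : ∀ R : Multiset ℂ, (∀ w ∈ R, w.im < 0) → R ≠ 0 →
      ((R.map fun z => 1 / ((0 : ℂ) - z)).sum).im < 0 := by
    intro R
    induction R using Multiset.induction_on with
    | empty => intro _ h; exact absurd rfl h
    | cons w R ih =>
      intro hw _
      have h1 : (1 / ((0 : ℂ) - w)).im < 0 := by
        have hwi := hw w (Multiset.mem_cons_self w R)
        have hn : 0 < Complex.normSq w := by
          rw [Complex.normSq_pos]; rintro rfl; simp at hwi
        simp only [zero_sub, one_div, Complex.inv_im, Complex.neg_im, neg_neg, Complex.normSq_neg]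
        exact div_neg_of_neg_of_pos hwi hn
      rw [Multiset.map_cons, Multiset.sum_cons, Complex.add_im]
      by_cases hR : R = 0
      · subst hR; simpa using h1
      · have := ih (fun v hv => hw v (Multiset.mem_cons_of_mem hv)) hR
        linarith
  have hneg := him f.roots (fun w hw => by
    by_contra hcon
    exact hroot w (not_lt.mp hcon) (isRoot_of_mem_roots hw)) (by
    intro h0
    have := hspl.natDegree_eq_card_roots
    rw [h0] at this
    simp at this
    omega)
  rw [← hsum] at hneg
  simp at hneg

theorem pos_of_ne (Cc : ConvexCone ℝ (ι → ℝ)) (p : MvPolynomial ι ℝ)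
    (hne : ∀ y ∈ Cc, MvPolynomial.aeval y p ≠ (0 : ℝ)) {e : ι → ℝ} (he : e ∈ Cc)
    (hpe : (0 : ℝ) < MvPolynomial.aeval e p) {y : ι → ℝ} (hy : y ∈ Cc) :
    (0 : ℝ) < MvPolynomial.aeval y p := by
  have hpre : IsPreconnected (Cc : Set (ι → ℝ)) := Cc.convex.isPreconnected
  by_contra hcon
  have hcont : Continuous fun x : ι → ℝ => (MvPolynomial.aeval x p : ℝ) :=
    cont_aeval p continuous_id
  have := hpre.intermediate_value hy he hcont.continuousOn
  obtain ⟨z, hz, hz0⟩ := this ⟨not_lt.mp hcon, hpe.le⟩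
  exact hne z hz hz0

theorem dirD_self {d : ℕ} {p : MvPolynomial ι ℝ} (hp : p.IsHomogeneous d) (a : ι → ℝ) :
    (MvPolynomial.aeval a (dirD a p) : ℝ) = d * MvPolynomial.aeval a p := by
  have := congrArg (MvPolynomial.aeval a) hp.sum_X_mul_pderiv
  rw [dirD_eq]
  simpa using this

theorem pos_dirD {d : ℕ} (hd : 1 ≤ d) {p : MvPolynomial ι ℝ} (hp : p.IsHomogeneous d)
    (Cc : ConvexCone ℝ (ι → ℝ)) (hC : (Cc : Set (ι → ℝ)) ⊆ H p)
    (hpos : ∀ y ∈ Cc, (0 : ℝ) < MvPolynomial.aeval y p) {a : ι → ℝ} (ha : a ∈ Cc) :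
    ∀ y ∈ Cc, (0 : ℝ) < MvPolynomial.aeval y (dirD a p) := by
  intro y hy
  refine pos_of_ne Cc _ (fun z hz => H_ne (dirD_hom a hp) (H_dirD hd hp Cc hC ha hz)) ha ?_ hy
  rw [dirD_self hp]
  have : (0 : ℝ) < d := by exact_mod_cast hd
  exact mul_pos this (hpos a ha)

/-- mixed differences are nonnegative -/
theorem diff_nonneg {J : Type*} [DecidableEq J] (Cc : ConvexCone ℝ (ι → ℝ)) (hne : ∃ e, e ∈ Cc)
    (b : J → ι → ℝ) (S : Finset J) (hb : ∀ j ∈ S, b j ∈ Cc) (p : MvPolynomial ι ℝ)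
    (hp : p.IsHomogeneous S.card) (hC : (Cc : Set (ι → ℝ)) ⊆ H p)
    (hpos : ∀ y ∈ Cc, (0 : ℝ) < MvPolynomial.aeval y p) (x : ι → ℝ) :
    (0 : ℝ) ≤ ∑ T ∈ S.powerset, (-1) ^ (S.card + T.card) *
      MvPolynomial.aeval (x + ∑ j ∈ T, b j) p := by
  induction S using Finset.induction_on generalizing p x with
  | empty =>
    obtain ⟨e, he⟩ := hne
    have h0 : p.IsHomogeneous 0 := by simpa using hp
    rw [← MvPolynomial.totalDegree_zero_iff_isHomogeneous,
      MvPolynomial.totalDegree_eq_zero_iff_eq_C] at h0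
    have := hpos e he
    rw [h0] at this ⊢
    simpa using this.le
  | insert j S hj ih =>
    have hcard : (insert j S).card = S.card + 1 := Finset.card_insert_of_notMem hj
    rw [hcard] at hp
    have hbj := hb j (Finset.mem_insert_self j S)
    have hD : (dirD (b j) p).IsHomogeneous S.card := by simpa using dirD_hom (b j) hp
    have key := fun x => ih (fun k hk => hb k (Finset.mem_insert_of_mem hk)) (dirD (b j) p) hD
      (H_dirD (by omega) hp Cc hC hbj) (pos_dirD (by omega) hp Cc hC hpos hbj) x
    let h : ℝ → ℝ := fun t => ∑ T ∈ S.powerset, (-1 : ℝ) ^ (S.card + T.card) *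
      (line (x + ∑ k ∈ T, b k) (b j) p).eval t
    have hev : ∀ (q : MvPolynomial ι ℝ) (T : Finset J) (t : ℝ),
        (line (x + ∑ k ∈ T, b k) (b j) q).eval t =
          MvPolynomial.aeval ((x + t • b j) + ∑ k ∈ T, b k) q := by
      intro q T t
      rw [eval_line]
      congr 2
      funext i
      simp
      ring
    have hderiv : ∀ t, HasDerivAt h (∑ T ∈ S.powerset, (-1 : ℝ) ^ (S.card + T.card) *
        (derivative (line (x + ∑ k ∈ T, b k) (b j) p)).eval t) t := by
      intro t
      exact HasDerivAt.fun_sum fun T _ => ((Polynomial.hasDerivAt _ t).const_mul _)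
    have hmono : Monotone h := monotone_of_hasDerivAt_nonneg hderiv (by
      intro t
      have := key (x + t • b j)
      simp only [derivative_line, hev]
      exact this)
    have h01 := hmono (zero_le_one' ℝ)
    rw [Finset.sum_powerset_insert hj, hcard]
    simp only [h, hev] at h01
    have e1 : ∑ T ∈ S.powerset, (-1 : ℝ) ^ (S.card + 1 + T.card) *
        MvPolynomial.aeval (x + ∑ j ∈ T, b j) p = - ∑ T ∈ S.powerset,
        (-1 : ℝ) ^ (S.card + T.card) * MvPolynomial.aeval ((x + (0:ℝ) • b j) + ∑ k ∈ T, b k) p := by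
      rw [← Finset.sum_neg_distrib]
      refine Finset.sum_congr rfl fun T _ => ?_
      rw [zero_smul, add_zero]; ring
    have e2 : ∑ T ∈ S.powerset, (-1 : ℝ) ^ (S.card + 1 + (insert j T).card) *
        MvPolynomial.aeval (x + ∑ j ∈ insert j T, b j) p = ∑ T ∈ S.powerset,
        (-1 : ℝ) ^ (S.card + T.card) * MvPolynomial.aeval ((x + (1:ℝ) • b j) + ∑ k ∈ T, b k) p := by
      refine Finset.sum_congr rfl fun T hT => ?_
      have hjT : j ∉ T := fun h => hj (Finset.mem_powerset.mp hT h)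
      rw [Finset.card_insert_of_notMem hjT, Finset.sum_insert hjT, one_smul, add_assoc x]
      ring
    rw [e1, e2]
    linarith

end Hess

namespace Hess

set_option linter.unusedSectionVars false

open Polynomial Topology

variable {ι : Type*} [Fintype ι]

theorem norm_lower {d : ℕ} {p : MvPolynomial ι ℝ} (hp : p.IsHomogeneous d)
    (z : ι → ℂ) (a : ι → ℝ) (ha : MvPolynomial.aeval a p ≠ (0 : ℝ))
    (hroot : ∀ s : ℂ, 0 ≤ s.im → (line z a p).eval s ≠ 0) (s : ℂ) (hs : 0 < s.im) :
    |(MvPolynomial.aeval a p : ℝ)| * s.im ^ d ≤ ‖(line z a p).eval s‖ := by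
  have hdeg := line_deg hp z a
  have hne : (line z a p).coeff d ≠ 0 := by
    rw [hdeg.2]; exact_mod_cast ha
  have hnd : (line z a p).natDegree = d := le_antisymm hdeg.1 (le_natDegree_of_ne_zero hne)
  have hspl : (line z a p).Splits := IsAlgClosed.splits _
  have hlc : (line z a p).leadingCoeff = ((MvPolynomial.aeval a p : ℝ) : ℂ) := by
    rw [leadingCoeff, hnd, hdeg.2]
  have hcard : (line z a p).roots.card = d := by
    rw [← hspl.natDegree_eq_card_roots, hnd]
  rw [hspl.eval_eq_prod_roots, norm_mul, hlc, Complex.norm_real, Real.norm_eq_abs]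
  refine mul_le_mul_of_nonneg_left ?_ (abs_nonneg _)
  have hR : ∀ R : Multiset ℂ, (∀ w ∈ R, w.im < 0) →
      s.im ^ R.card ≤ ‖(R.map fun w => s - w).prod‖ := by
    intro R
    induction R using Multiset.induction_on with
    | empty => intro _; simp
    | cons w R ih =>
      intro hw
      rw [Multiset.map_cons, Multiset.prod_cons, Multiset.card_cons, pow_succ', norm_mul]
      refine mul_le_mul ?_ (ih fun v hv => hw v (Multiset.mem_cons_of_mem hv))
        (by positivity) (norm_nonneg _)
      have h1 := hw w (Multiset.mem_cons_self w R)
      have h2 := Complex.abs_im_le_norm (s - w)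
      have h3 := le_abs_self (s - w).im
      rw [Complex.sub_im] at h2 h3
      linarith
  have := hR (line z a p).roots (fun w hw => by
    by_contra hcon
    exact hroot w (not_lt.mp hcon) (isRoot_of_mem_roots hw))
  rwa [hcard] at this

theorem base_case {d : ℕ} {p : MvPolynomial ι ℝ} (hp : p.IsHomogeneous d) {e a : ι → ℝ}
    (he : e ∈ H p) (ha : ∀ t : ℝ, 0 ≤ t → MvPolynomial.aeval (a + t • e) p ≠ (0 : ℝ))
    (s : ℂ) (hs : 0 ≤ s.im) : (line (cpt 0 e) a p).eval s ≠ 0 := by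
  intro h0
  by_cases hs0 : s = 0
  · rw [hs0, eval_line] at h0
    exact he 0 (by simpa using h0)
  set w : ℂ := Complex.I / s with hw
  have h1 : MvPolynomial.aeval (fun i => (a i : ℂ) + w * (e i : ℂ)) p = 0 := by
    rw [eval_line] at h0
    have : (fun i => cpt 0 e i + algebraMap ℝ ℂ (a i) * s) =
        fun i => s * ((a i : ℂ) + w * (e i : ℂ)) := by
      funext i
      simp only [cpt, hw, Complex.coe_algebraMap, Pi.zero_apply]
      field_simp
      push_cast
      ring
    rw [this, aeval_smul_hom hp] at h0
    exact (mul_eq_zero.mp h0).resolve_left (pow_ne_zero _ hs0)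
  have hpt : (fun i => (a i : ℂ) + w * (e i : ℂ)) = cpt (a + w.re • e) (w.im • e) := by
    funext i
    simp only [cpt, Pi.add_apply, Pi.smul_apply, smul_eq_mul]
    push_cast
    conv_lhs => rw [← Complex.re_add_im w]
    ring
  rw [hpt] at h1
  by_cases him : w.im = 0
  · have : cpt (a + w.re • e) (w.im • e) = fun i => (((a + w.re • e) i : ℝ) : ℂ) := by
      funext i; simp [cpt, him]
    rw [this, aeval_ofReal] at h1
    refine ha w.re ?_ (by exact_mod_cast h1)
    rw [hw, Complex.div_re]
    simp
    exact div_nonneg hs (Complex.normSq_nonneg _)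
  · exact H_smul hp he him _ h1

theorem ext_aux {d : ℕ} {p : MvPolynomial ι ℝ} (hp : p.IsHomogeneous d)
    (Cc : ConvexCone ℝ (ι → ℝ)) (hC : (Cc : Set (ι → ℝ)) ⊆ H p) {e a : ι → ℝ} (he : e ∈ Cc)
    (ha : ∀ t : ℝ, 0 ≤ t → MvPolynomial.aeval (a + t • e) p ≠ (0 : ℝ))
    {c : ι → ℝ} (hc : c ∈ Cc) (x : ι → ℝ) (s : ℂ) (hs : 0 ≤ s.im) :
    (line (cpt x c) a p).eval s ≠ 0 := by
  have ha0 : MvPolynomial.aeval a p ≠ (0 : ℝ) := by simpa using ha 0 le_rfl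
  let z : unitInterval → ι → ℂ := fun r =>
    cpt ((r : ℝ) • x) ((1 - (r : ℝ)) • e + (r : ℝ) • c)
  have hz : Continuous z := by
    refine continuous_pi fun i => ?_
    simp only [z, cpt, Pi.add_apply, Pi.smul_apply, smul_eq_mul]
    fun_prop
  have hzi : ∀ i, Continuous fun r => z r i := fun i => (continuous_apply i).comp hz
  have hmem : ∀ r : unitInterval, (1 - (r : ℝ)) • e + (r : ℝ) • c ∈ Cc := fun r =>
    Cc.convex he hc (by linarith [r.2.2]) r.2.1 (by ring)
  have hreal : ∀ (r : unitInterval) (w : ℂ), w.im = 0 → (line (z r) a p).eval w ≠ 0 := by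
    intro r w hw h0
    apply hC (hmem r) ((r : ℝ) • x + w.re • a)
    rw [eval_line] at h0
    rw [← h0]
    congr 2
    funext i
    have : w = (w.re : ℂ) := by apply Complex.ext <;> simp [hw]
    rw [this]
    simp only [z, cpt, Pi.add_apply, Pi.smul_apply, smul_eq_mul, Complex.coe_algebraMap,
      Complex.ofReal_re]
    push_cast
    ring
  have hF : Continuous fun q : unitInterval × ℂ => (line (z q.1) a p).eval q.2 := by
    simp only [eval_line]
    refine cont_aeval p (continuous_pi fun i => ?_)
    have := (hzi i).comp (continuous_fst (X := unitInterval) (Y := ℂ))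
    simp only [Function.comp_def] at this
    fun_prop
  -- roots are bounded
  obtain ⟨R, hR⟩ : ∃ R : ℝ, ∀ (r : unitInterval) (w : ℂ), (line (z r) a p).eval w = 0 →
      ‖w‖ ≤ R := by
    have hG : Continuous fun q : ℂ × unitInterval =>
        MvPolynomial.aeval (fun i => (a i : ℂ) + q.1 * z q.2 i) p := by
      refine cont_aeval p (continuous_pi fun i => ?_)
      have := (hzi i).comp (continuous_snd (X := ℂ) (Y := unitInterval))
      simp only [Function.comp_def] at this
      fun_prop
    have hev : ∀ᶠ u : ℂ in 𝓝 0, ∀ r ∈ (Set.univ : Set unitInterval),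
        MvPolynomial.aeval (fun i => (a i : ℂ) + u * z r i) p ≠ 0 := by
      refine IsCompact.eventually_forall_of_forall_eventually isCompact_univ fun r _ => ?_
      refine hG.continuousAt.eventually_ne ?_
      simp only [zero_mul, add_zero]
      rw [aeval_ofReal]
      exact_mod_cast ha0
    obtain ⟨δ, hδ, hball⟩ := Metric.eventually_nhds_iff.mp hev
    refine ⟨δ⁻¹, fun r w h0 => ?_⟩
    by_contra hcon
    have hw : δ⁻¹ < ‖w‖ := not_le.mp hcon
    have hwpos : 0 < ‖w‖ := lt_trans (by positivity) hw
    have hw0 : w ≠ 0 := norm_pos_iff.mp hwpos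
    apply hball (y := w⁻¹) (by
      rw [dist_zero_right, norm_inv]
      exact inv_lt_of_inv_lt₀ hδ hw) r (Set.mem_univ r)
    rw [eval_line] at h0
    have : (fun i => z r i + algebraMap ℝ ℂ (a i) * w) =
        fun i => w * ((a i : ℂ) + w⁻¹ * z r i) := by
      funext i
      simp only [Complex.coe_algebraMap]
      field_simp
      ring
    rw [this, aeval_smul_hom hp] at h0
    exact (mul_eq_zero.mp h0).resolve_left (pow_ne_zero _ hw0)
  let U : Set unitInterval := {r | ∃ w : ℂ, 0 ≤ w.im ∧ (line (z r) a p).eval w = 0}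
  have hUc : IsClosed U := by
    have hK : IsCompact ((Set.univ ×ˢ Metric.closedBall (0 : ℂ) R) ∩
        {q : unitInterval × ℂ | 0 ≤ q.2.im ∧ (line (z q.1) a p).eval q.2 = 0}) := by
      refine (isCompact_univ.prod (isCompact_closedBall _ _)).inter_right ?_
      refine IsClosed.inter ?_ ?_
      · exact isClosed_le continuous_const (Complex.continuous_im.comp continuous_snd)
      · exact isClosed_eq hF continuous_const
    have hUeq : U = Prod.fst '' ((Set.univ ×ˢ Metric.closedBall (0 : ℂ) R) ∩
        {q : unitInterval × ℂ | 0 ≤ q.2.im ∧ (line (z q.1) a p).eval q.2 = 0}) := by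
      ext r
      constructor
      · rintro ⟨w, hw, h0⟩
        exact ⟨(r, w), ⟨⟨Set.mem_univ _, by simpa using hR r w h0⟩, hw, h0⟩, rfl⟩
      · rintro ⟨⟨r', w⟩, ⟨_, hw, h0⟩, rfl⟩
        exact ⟨w, hw, h0⟩
    rw [hUeq]
    exact (hK.image continuous_fst).isClosed
  have hUo : IsOpen U := by
    rw [isOpen_iff_mem_nhds]
    rintro r ⟨w, hw, h0⟩
    have hwpos : 0 < w.im := by
      rcases hw.eq_or_lt with h | h
      · exact absurd h0 (hreal r w h.symm)
      · exact h
    have hFw : Continuous fun r => ‖(line (z r) a p).eval w‖ :=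
      (hF.comp (continuous_id.prodMk continuous_const)).norm
    have hlt : ‖(line (z r) a p).eval w‖ < |(MvPolynomial.aeval a p : ℝ)| * w.im ^ d := by
      rw [h0, norm_zero]
      have := abs_pos.mpr ha0
      positivity
    filter_upwards [hFw.continuousAt.eventually_lt continuousAt_const hlt] with r' hr'
    by_contra hcon
    have := norm_lower hp (z r') a ha0 (fun s hs h => hcon ⟨s, hs, h⟩) w hwpos
    linarith
  rcases isClopen_iff.mp ⟨hUc, hUo⟩ with h | h
  · intro h0
    have : (1 : unitInterval) ∈ U := ⟨s, hs, by simpa [z] using h0⟩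
    rw [h] at this
    exact this
  · exfalso
    have : (0 : unitInterval) ∈ U := by rw [h]; trivial
    obtain ⟨w, hw, h0⟩ := this
    have h0' : (line (cpt 0 e) a p).eval w = 0 := by simpa [z] using h0
    exact base_case hp (hC he) ha w hw h0'

/-- The cone `C + ℝ≥0 a`. -/
def extCone (Cc : ConvexCone ℝ (ι → ℝ)) (a : ι → ℝ) : ConvexCone ℝ (ι → ℝ) where
  carrier := {y | ∃ c ∈ Cc, ∃ v : ℝ, 0 ≤ v ∧ y = c + v • a}
  smul_mem' := by
    rintro t ht _ ⟨c, hc, v, hv, rfl⟩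
    exact ⟨t • c, Cc.smul_mem ht hc, t * v, by positivity, by rw [smul_add, smul_smul]⟩
  add_mem' := by
    rintro _ ⟨c, hc, v, hv, rfl⟩ _ ⟨c', hc', v', hv', rfl⟩
    exact ⟨c + c', Cc.add_mem hc hc', v + v', by positivity, by rw [add_smul]; abel⟩

/-- The ray through `e`. -/
def rayCone (e : ι → ℝ) : ConvexCone ℝ (ι → ℝ) where
  carrier := {y | ∃ t : ℝ, 0 < t ∧ y = t • e}
  smul_mem' := by
    rintro t ht _ ⟨c, hc, rfl⟩
    exact ⟨t * c, by positivity, by rw [smul_smul]⟩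
  add_mem' := by
    rintro _ ⟨c, hc, rfl⟩ _ ⟨c', hc', rfl⟩
    exact ⟨c + c', by positivity, by rw [add_smul]⟩

theorem exists_cone {J : Type*} [DecidableEq J] {d : ℕ} {p : MvPolynomial ι ℝ}
    (hp : p.IsHomogeneous d) {e : ι → ℝ} (he : e ∈ H p) (a : J → ι → ℝ) (S : Finset J)
    (ha : ∀ j ∈ S, ∀ t : ℝ, 0 ≤ t → MvPolynomial.aeval (a j + t • e) p ≠ (0 : ℝ)) :
    ∃ Cc : ConvexCone ℝ (ι → ℝ), (Cc : Set (ι → ℝ)) ⊆ H p ∧ e ∈ Cc ∧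
      ∀ j ∈ S, ∀ c ∈ Cc, c + a j ∈ Cc := by
  induction S using Finset.induction_on with
  | empty =>
    refine ⟨rayCone e, ?_, ⟨1, one_pos, by simp⟩, by simp⟩
    rintro _ ⟨t, ht, rfl⟩
    exact H_smul hp he ht.ne'
  | insert j S hj ih =>
    obtain ⟨Cc, hC, heC, hS⟩ := ih fun k hk => ha k (Finset.mem_insert_of_mem hk)
    refine ⟨extCone Cc (a j), ?_, ⟨e, heC, 0, le_rfl, by simp⟩, ?_⟩
    · rintro _ ⟨c, hc, v, hv, rfl⟩ x h0
      refine ext_aux hp Cc hC heC (ha j (Finset.mem_insert_self j S)) hc x (Complex.I * v)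
        (by simpa using hv) ?_
      rw [eval_line, ← h0]
      congr 2
      funext i
      simp only [cpt, Complex.coe_algebraMap, Pi.add_apply, Pi.smul_apply, smul_eq_mul]
      push_cast
      ring
    · rintro k hk _ ⟨c, hc, v, hv, rfl⟩
      rcases Finset.mem_insert.mp hk with rfl | hk
      · exact ⟨c, hc, v + 1, by positivity, by rw [add_smul, one_smul, add_assoc]⟩
      · exact ⟨c + a k, hS k hk c hc, v, hv, by abel⟩

/-- Gårding's inequality, abstract form. -/
theorem garding {J : Type*} [DecidableEq J] [Fintype J] {p : MvPolynomial ι ℝ}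
    (hp : p.IsHomogeneous (Fintype.card J)) {e : ι → ℝ} (he : e ∈ H p)
    (hpe : (0 : ℝ) < MvPolynomial.aeval e p) (a : J → ι → ℝ)
    (ha : ∀ j, ∀ t : ℝ, 0 < t → (0 : ℝ) < MvPolynomial.aeval (a j + t • e) p) :
    (0 : ℝ) ≤ ∑ T : Finset J, (-1) ^ (Fintype.card J + T.card) *
      MvPolynomial.aeval (∑ j ∈ T, a j) p := by
  have hε : ∀ ε : ℝ, 0 < ε → (0 : ℝ) ≤ ∑ T : Finset J, (-1) ^ (Fintype.card J + T.card) *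
      MvPolynomial.aeval (∑ j ∈ T, (a j + (2 * ε) • e)) p := by
    intro ε hε
    obtain ⟨Cc, hC, heC, hS⟩ := exists_cone hp he (fun j => a j + ε • e) Finset.univ (by
      intro j _ t ht
      have := ha j (ε + t) (by positivity)
      rw [add_assoc, ← add_smul]
      exact this.ne')
    have := diff_nonneg Cc ⟨e, heC⟩ (fun j => a j + (2 * ε) • e) Finset.univ (by
      intro j hj
      have := hS j hj (ε • e) (Cc.smul_mem hε heC)
      convert this using 1
      rw [two_mul, add_smul]; abel) p (by simpa using hp) hC
      (fun y hy => pos_of_ne Cc p (fun z hz => H_ne hp (hC hz)) heC hpe hy) 0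
    simpa using this
  have hcont : Continuous fun ε : ℝ => ∑ T : Finset J, (-1 : ℝ) ^ (Fintype.card J + T.card) *
      (MvPolynomial.aeval (∑ j ∈ T, (a j + (2 * ε) • e)) p : ℝ) := by
    refine continuous_finsetSum _ fun T _ => continuous_const.mul (cont_aeval p ?_)
    fun_prop
  have hlim := (hcont.tendsto 0).mono_left (nhdsWithin_le_nhds (s := Set.Ioi 0))
  have := ge_of_tendsto hlim (by
    filter_upwards [self_mem_nhdsWithin] with ε hε'
    exact hε ε hε')
  simpa using this

end Hess

namespace Hess

set_option linter.unusedSectionVars false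

open Polynomial Topology

theorem sigmaH_congr {n : ℕ} {A B : Matrix (Fin n) (Fin n) ℂ} (hA : A.IsHermitian)
    (hB : B.IsHermitian) (h : A = B) (k : ℕ) : sigmaH hA k = sigmaH hB k := by
  subst h; rfl

theorem det_add_smul {n : ℕ} {B : Matrix (Fin n) (Fin n) ℂ} (hB : B.IsHermitian) (s : ℂ) :
    (B + s • (1 : Matrix (Fin n) (Fin n) ℂ)).det = ∏ i, ((hB.eigenvalues i : ℂ) + s) := by
  have h1 := Matrix.eval_charpoly B (-s)
  rw [hB.charpoly_eq, eval_prod] at h1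
  have h2 : Matrix.scalar (Fin n) (-s) - B = -(B + s • (1 : Matrix (Fin n) (Fin n) ℂ)) := by
    ext i j
    simp [Matrix.scalar_apply, Matrix.diagonal_apply, Matrix.one_apply]
    split_ifs <;> ring
  rw [h2, Matrix.det_neg] at h1
  have h3 : ∏ i, eval (-s) (X - C ((hB.eigenvalues i : ℝ) : ℂ)) =
      (-1) ^ Fintype.card (Fin n) * ∏ i, ((hB.eigenvalues i : ℂ) + s) := by
    rw [← Finset.card_univ, ← Finset.prod_const, ← Finset.prod_mul_distrib]
    refine Finset.prod_congr rfl fun i _ => ?_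
    simp
    ring
  have h4 : ((-1 : ℂ)) ^ Fintype.card (Fin n) ≠ 0 := by simp
  exact (mul_left_cancel₀ h4 (h3.symm.trans h1)).symm

variable {n m : ℕ}

/-- the pencil of matrices -/
noncomputable def pencil (A : Fin m → Matrix (Fin n) (Fin n) ℂ) (z : Option (Fin m) → ℂ) :
    Matrix (Fin n) (Fin n) ℂ :=
  z none • 1 + ∑ j, z (some j) • A j

theorem pencil_herm (A : Fin m → Matrix (Fin n) (Fin n) ℂ) (hA : ∀ j, (A j).IsHermitian)
    (x : Option (Fin m) → ℝ) : (pencil A (fun i => (x i : ℂ))).IsHermitian := by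
  unfold Matrix.IsHermitian pencil
  rw [Matrix.conjTranspose_add, Matrix.conjTranspose_sum, Matrix.conjTranspose_smul]
  congr 1
  · simp
  · refine Finset.sum_congr rfl fun j _ => ?_
    rw [Matrix.conjTranspose_smul, hA j]
    simp

theorem exists_Q (A : Fin m → Matrix (Fin n) (Fin n) ℂ) (hA : ∀ j, (A j).IsHermitian) :
    ∃ Q : MvPolynomial (Option (Fin m)) ℝ, Q.IsHomogeneous n ∧
      ∀ z : Option (Fin m) → ℂ, MvPolynomial.aeval z Q = (pencil A z).det := by
  let N : Matrix (Fin n) (Fin n) (MvPolynomial (Option (Fin m)) ℂ) := fun i k =>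
    MvPolynomial.C ((1 : Matrix (Fin n) (Fin n) ℂ) i k) * MvPolynomial.X none +
      ∑ j, MvPolynomial.C (A j i k) * MvPolynomial.X (some j)
  have hNhom : ∀ i k, (N i k).IsHomogeneous 1 := fun i k =>
    (MvPolynomial.isHomogeneous_C_mul_X _ _).add
      (MvPolynomial.IsHomogeneous.sum _ _ _ fun j _ => MvPolynomial.isHomogeneous_C_mul_X _ _)
  have hhom : N.det.IsHomogeneous n := by
    rw [Matrix.det_apply]
    refine MvPolynomial.IsHomogeneous.sum _ _ _ fun σ _ => ?_
    have h1 : (∏ i, N (σ i) i).IsHomogeneous n := by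
      have := MvPolynomial.IsHomogeneous.prod Finset.univ (fun i => N (σ i) i) (fun _ => 1)
        (fun i _ => hNhom _ _)
      simpa using this
    rcases Int.units_eq_one_or (Equiv.Perm.sign σ) with h | h
    · rw [h, one_smul]; exact h1
    · rw [h, Units.neg_smul, one_smul]; exact h1.neg
  have hconj : MvPolynomial.map (starRingEnd ℂ) N.det = N.det := by
    rw [RingHom.map_det, ← Matrix.det_transpose N]
    congr 1
    ext1 i k
    rw [Matrix.transpose_apply, RingHom.mapMatrix_apply, Matrix.map_apply]
    simp only [N, map_add, map_mul, map_sum, MvPolynomial.map_C, MvPolynomial.map_X]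
    congr 1
    · congr 2
      simp only [Matrix.one_apply, eq_comm (a := i) (b := k)]
      split_ifs <;> simp
    · refine Finset.sum_congr rfl fun j _ => ?_
      congr 2
      exact (hA j).apply k i
  have hrange : N.det ∈ Set.range (MvPolynomial.map (σ := Option (Fin m)) (algebraMap ℝ ℂ)) := by
    refine (MvPolynomial.mem_range_map_iff_coeffs_subset).mpr ?_
    intro c hc
    obtain ⟨s, hs, rfl⟩ := MvPolynomial.mem_coeffs_iff.mp hc
    have := congrArg (MvPolynomial.coeff s) hconj
    rw [MvPolynomial.coeff_map] at this
    obtain ⟨r, hr⟩ := Complex.conj_eq_iff_real.mp this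
    exact ⟨r, hr.symm⟩
  obtain ⟨Q, hQ⟩ := hrange
  refine ⟨Q, MvPolynomial.IsHomogeneous.of_map (f := algebraMap ℝ ℂ)
    (RingHom.injective _) (by rw [hQ]; exact hhom), fun z => ?_⟩
  have h1 : MvPolynomial.aeval z Q = MvPolynomial.eval z N.det := by
    rw [← hQ, MvPolynomial.eval_map]; rfl
  rw [h1, RingHom.map_det]
  congr 1
  ext i k
  rw [RingHom.mapMatrix_apply, Matrix.map_apply]
  simp [N, pencil, Matrix.sum_apply, mul_comm]

/-- the direction of the identity matrix -/
def e0 : Option (Fin m) → ℝ := Pi.single none 1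

theorem pencil_add_e0 (A : Fin m → Matrix (Fin n) (Fin n) ℂ) (z : Option (Fin m) → ℂ) (s : ℂ) :
    pencil A (fun i => z i + ((e0 i : ℝ) : ℂ) * s) = pencil A z + s • 1 := by
  simp only [pencil, e0]
  simp [add_smul]
  abel

theorem line_Q (A : Fin m → Matrix (Fin n) (Fin n) ℂ) (hA : ∀ j, (A j).IsHermitian)
    {Q : MvPolynomial (Option (Fin m)) ℝ}
    (hQ : ∀ z : Option (Fin m) → ℂ, MvPolynomial.aeval z Q = (pencil A z).det)
    (x : Option (Fin m) → ℝ) :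
    line x e0 Q = ∏ i, (X + C ((pencil_herm A hA x).eigenvalues i)) := by
  refine Polynomial.funext fun s => ?_
  rw [eval_line, eval_prod]
  have h : ((MvPolynomial.aeval (fun i => x i + algebraMap ℝ ℝ (e0 i) * s) Q : ℝ) : ℂ) =
      ((∏ i, eval s (X + C ((pencil_herm A hA x).eigenvalues i)) : ℝ) : ℂ) := by
    rw [← aeval_ofReal, hQ]
    have h1 := pencil_add_e0 A (fun i => (x i : ℂ)) (s : ℂ)
    have h2 := det_add_smul (pencil_herm A hA x) (s : ℂ)
    rw [← h1] at h2
    simp only [Algebra.algebraMap_self, RingHom.id_apply]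
    push_cast
    rw [h2]
    refine Finset.prod_congr rfl fun i _ => ?_
    simp [add_comm]
  exact_mod_cast h

theorem e0_mem_H (A : Fin m → Matrix (Fin n) (Fin n) ℂ) (hA : ∀ j, (A j).IsHermitian)
    {Q : MvPolynomial (Option (Fin m)) ℝ}
    (hQ : ∀ z : Option (Fin m) → ℂ, MvPolynomial.aeval z Q = (pencil A z).det) :
    e0 ∈ H Q := by
  intro x h
  have h1 : cpt x e0 = fun i => (x i : ℂ) + ((e0 i : ℝ) : ℂ) * Complex.I := by
    funext i; simp [cpt, mul_comm]
  rw [h1, hQ, pencil_add_e0 A (fun i => (x i : ℂ)), det_add_smul (pencil_herm A hA x),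
    Finset.prod_eq_zero_iff] at h
  obtain ⟨i, _, hi⟩ := h
  have := congrArg Complex.im hi
  simp at this

theorem iter_props {ι : Type*} [Fintype ι] {Q : MvPolynomial ι ℝ} (hQ : Q.IsHomogeneous n)
    {e : ι → ℝ} (he : e ∈ H Q) (hpos : (0 : ℝ) < MvPolynomial.aeval e Q) (k : ℕ) (hk : k ≤ n) :
    ((dirD e)^[k] Q).IsHomogeneous (n - k) ∧ e ∈ H ((dirD e)^[k] Q) ∧
      (0 : ℝ) < MvPolynomial.aeval e ((dirD e)^[k] Q) := by
  induction k with
  | zero => exact ⟨hQ, he, hpos⟩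
  | succ k ih =>
    obtain ⟨h1, h2, h3⟩ := ih (by omega)
    rw [Function.iterate_succ_apply']
    have heC : e ∈ rayCone e := ⟨1, one_pos, by simp⟩
    have hC : (rayCone e : Set (ι → ℝ)) ⊆ H ((dirD e)^[k] Q) := by
      rintro _ ⟨t, ht, rfl⟩
      exact H_smul h1 h2 ht.ne'
    have hp : ∀ y ∈ rayCone e, (0 : ℝ) < MvPolynomial.aeval y ((dirD e)^[k] Q) := fun y hy =>
      pos_of_ne _ _ (fun z hz => H_ne h1 (hC hz)) heC h3 hy
    exact ⟨by simpa [Nat.sub_sub] using dirD_hom e h1,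
      H_dirD (by omega) h1 _ hC heC heC, pos_dirD (by omega) h1 _ hC hp heC e heC⟩

theorem coeff_P (A : Fin m → Matrix (Fin n) (Fin n) ℂ) (hA : ∀ j, (A j).IsHermitian)
    (hmn : m ≤ n) {Q : MvPolynomial (Option (Fin m)) ℝ}
    (hQ : ∀ z : Option (Fin m) → ℂ, MvPolynomial.aeval z Q = (pencil A z).det)
    (x : Option (Fin m) → ℝ) (j : ℕ) (hj : j ≤ m) :
    (line x e0 ((dirD e0)^[n - m] Q)).coeff j =
      ((j + (n - m)).descFactorial (n - m) : ℝ) * sigmaH (pencil_herm A hA x) (m - j) := by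
  rw [← iter_derivative_line, coeff_iterate_derivative, line_Q A hA hQ x,
    Finset.prod_X_add_C_coeff _ _ (by simp; omega), nsmul_eq_mul, sigmaH]
  congr 3
  simp
  omega

theorem coeff_P_gt (A : Fin m → Matrix (Fin n) (Fin n) ℂ) (hA : ∀ j, (A j).IsHermitian)
    (hmn : m ≤ n) {Q : MvPolynomial (Option (Fin m)) ℝ}
    (hQ : ∀ z : Option (Fin m) → ℂ, MvPolynomial.aeval z Q = (pencil A z).det)
    (x : Option (Fin m) → ℝ) (j : ℕ) (hj : m < j) :
    (line x e0 ((dirD e0)^[n - m] Q)).coeff j = 0 := by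
  rw [← iter_derivative_line, coeff_iterate_derivative, line_Q A hA hQ x,
    coeff_eq_zero_of_natDegree_lt, smul_zero]
  rw [natDegree_prod_of_monic _ _ fun i _ => monic_X_add_C _]
  simp
  omega

end Hess

/-- Nonnegativity of the polarized Hessian form: if `σ_k(A_j) ≥ 0` for all
`k = 1,…,m` and `j = 1,…,m`, then `D_m(A₁,…,A_m) ≥ 0`. -/
theorem Dpol_nonneg {n m : ℕ} (hn : 1 ≤ n) (hm : 1 ≤ m) (hmn : m ≤ n)
    (A : Fin m → Matrix (Fin n) (Fin n) ℂ) (hA : ∀ j, (A j).IsHermitian)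
    (hσ : ∀ j, ∀ k, 1 ≤ k → k ≤ m → 0 ≤ sigmaH (hA j) k) :
    0 ≤ Dpol A hA := by
  classical
  obtain ⟨Q, hQh, hQ⟩ := Hess.exists_Q A hA
  have he := Hess.e0_mem_H A hA hQ
  have hpen0 : Hess.pencil A (fun i => ((Hess.e0 i : ℝ) : ℂ)) = 1 := by
    simp [Hess.pencil, Hess.e0]
  have hQpos : (0 : ℝ) < MvPolynomial.aeval Hess.e0 Q := by
    have h1 := hQ (fun i => ((Hess.e0 i : ℝ) : ℂ))
    rw [Hess.aeval_ofReal, hpen0, Matrix.det_one] at h1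
    have h2 : (MvPolynomial.aeval Hess.e0 Q : ℝ) = 1 := by exact_mod_cast h1
    rw [h2]; exact one_pos
  obtain ⟨hPh, hPe, hPpos⟩ := Hess.iter_props hQh he hQpos (n - m) (by omega)
  set P := (Hess.dirD Hess.e0)^[n - m] Q with hP
  have hnm : n - (n - m) = m := by omega
  rw [hnm] at hPh
  let a : Fin m → Option (Fin m) → ℝ := fun j => Pi.single (some j) 1
  have hpenT : ∀ T : Finset (Fin m),
      Hess.pencil A (fun i => (((∑ j ∈ T, a j) i : ℝ) : ℂ)) = ∑ j ∈ T, A j := by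
    intro T
    simp only [Hess.pencil, a, Finset.sum_apply]
    simp [Pi.single_apply]
  have hpenj : ∀ j, Hess.pencil A (fun i => ((a j i : ℝ) : ℂ)) = A j := by
    intro j
    have := hpenT {j}
    simpa using this
  have hval : ∀ T : Finset (Fin m), (MvPolynomial.aeval (∑ j ∈ T, a j) P : ℝ) =
      ((n - m).factorial : ℝ) * sigmaH (isHermitian_finsetSum A hA T) m := by
    intro T
    have h1 := Hess.coeff_P A hA hmn hQ (∑ j ∈ T, a j) 0 (Nat.zero_le m)
    rw [Polynomial.coeff_zero_eq_eval_zero, Hess.eval_line] at h1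
    rw [Hess.sigmaH_congr _ (isHermitian_finsetSum A hA T) (hpenT T)] at h1
    have h2 : (fun i => (∑ j ∈ T, a j) i + algebraMap ℝ ℝ (Hess.e0 i) * 0) = ∑ j ∈ T, a j := by
      funext i; simp
    rw [h2, Nat.zero_add, Nat.descFactorial_self, Nat.sub_zero] at h1
    exact h1
  have hpos : ∀ j, ∀ t : ℝ, 0 < t → (0 : ℝ) < MvPolynomial.aeval (a j + t • Hess.e0) P := by
    intro j t ht
    have h1 := Hess.eval_line (a j) Hess.e0 t P
    have h2 : (fun i => a j i + algebraMap ℝ ℝ (Hess.e0 i) * t) = a j + t • Hess.e0 := by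
      funext i; simp [mul_comm]
    rw [h2] at h1
    rw [← h1, Polynomial.eval_eq_sum_range]
    have hsig : ∀ k, k ≤ m → 0 ≤ sigmaH (Hess.pencil_herm A hA (a j)) k := by
      intro k hk
      rcases Nat.eq_zero_or_pos k with rfl | hk0
      · simp [sigmaH]
      · rw [Hess.sigmaH_congr _ (hA j) (hpenj j)]
        exact hσ j k hk0 hk
    have hc : ∀ k, 0 ≤ (Hess.line (a j) Hess.e0 P).coeff k := by
      intro k
      by_cases hk : k ≤ m
      · rw [hP, Hess.coeff_P A hA hmn hQ (a j) k hk]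
        exact mul_nonneg (Nat.cast_nonneg _) (hsig _ (Nat.sub_le _ _))
      · rw [hP, Hess.coeff_P_gt A hA hmn hQ (a j) k (by omega)]
    have hcm : 0 < (Hess.line (a j) Hess.e0 P).coeff m := by
      rw [hP, Hess.coeff_P A hA hmn hQ (a j) m le_rfl]
      have h3 : 0 < (m + (n - m)).descFactorial (n - m) :=
        Nat.descFactorial_pos.mpr (by omega)
      have h4 : sigmaH (Hess.pencil_herm A hA (a j)) (m - m) = 1 := by simp [sigmaH]
      rw [h4, mul_one]
      exact_mod_cast h3
    refine Finset.sum_pos' (fun k _ => mul_nonneg (hc k) (by positivity)) ⟨m, ?_, ?_⟩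
    · rw [Finset.mem_range]
      exact Nat.lt_succ_of_le (Polynomial.le_natDegree_of_ne_zero hcm.ne')
    · exact mul_pos hcm (by positivity)
  have main := Hess.garding (J := Fin m) (by simpa using hPh) hPe hPpos a hpos
  have hzero : sigmaH (isHermitian_finsetSum A hA ∅) m = 0 := by
    have h1 := hval ∅
    have h2 := Hess.aeval_smul_hom hPh (0 : ℝ) (0 : Option (Fin m) → ℝ)
    have h3 : (fun i => (0 : ℝ) * (0 : Option (Fin m) → ℝ) i) = ∑ j ∈ (∅ : Finset (Fin m)), a j := by
      funext i; simp
    rw [h3, h1, zero_pow (by omega), zero_mul] at h2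
    exact (mul_eq_zero.mp h2).resolve_left (by positivity)
  unfold Dpol
  refine mul_nonneg (by positivity) ?_
  have hsum : ∑ T : Finset (Fin m), (-1 : ℝ) ^ (Fintype.card (Fin m) + T.card) *
      (MvPolynomial.aeval (∑ j ∈ T, a j) P : ℝ) = ((n - m).factorial : ℝ) *
      ∑ T ∈ (Finset.univ : Finset (Finset (Fin m))).filter (fun T => T ≠ ∅),
      (-1 : ℝ) ^ (m - T.card) * sigmaH (isHermitian_finsetSum A hA T) m := by
    rw [Finset.mul_sum, Finset.sum_filter]
    refine Finset.sum_congr rfl fun T _ => ?_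
    split_ifs with hT
    · have hTc : T.card ≤ m := by simpa using Finset.card_le_univ T
      have hs : (-1 : ℝ) ^ (Fintype.card (Fin m) + T.card) = (-1) ^ (m - T.card) := by
        rw [Fintype.card_fin, show m + T.card = (m - T.card) + 2 * T.card by omega, pow_add,
          pow_mul]
        simp
      rw [hval, hs]; ring
    · have : T = ∅ := not_not.mp hT
      subst this
      rw [hval, hzero]; simp
  rw [hsum] at main
  exact nonneg_of_mul_nonneg_right main (by positivity)
end

section
/- Superadditivity of σ_m^{1/m} for Hermitian matrices: let A and B be n×n complex Hermitian matrices with σ_k(A) ≥ 0 and σ_k(B) ≥ 0 for every k = 1,…,m. Then σ_m(A + B)^{1/m} ≥ σ_m(A)^{1/m} + σ_m(B)^{1/m}, where t^{1/m} denotes the nonnegative real m-th root. -/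
namespace SR
open Finset Polynomial
set_option linter.unusedSectionVars false

noncomputable def E {ι : Type*} (s : Finset ι) (k : ℕ) (x : ι → ℝ) : ℝ :=
  ∑ S ∈ powersetCard k s, ∏ i ∈ S, x i

variable {ι : Type*} [DecidableEq ι]

lemma E_zero (s : Finset ι) (x : ι → ℝ) : E s 0 x = 1 := by simp [E]

lemma E_insert {s : Finset ι} {a : ι} (h : a ∉ s) (k : ℕ) (x : ι → ℝ) :
    E (insert a s) (k+1) x = E s (k+1) x + x a * E s k x := by
  unfold E
  rw [powersetCard_succ_insert h, sum_union, sum_image, mul_sum]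
  · congr 1
    refine sum_congr rfl fun T hT => ?_
    rw [prod_insert]
    exact fun hh => h ((mem_powersetCard.1 hT).1 hh)
  · intro T hT T' hT' hEq
    have h1 : a ∉ T := fun hh => h ((mem_powersetCard.1 hT).1 hh)
    have h2 : a ∉ T' := fun hh => h ((mem_powersetCard.1 hT').1 hh)
    rw [← erase_insert h1, ← erase_insert h2, hEq]
  · rw [disjoint_left]
    intro T hT hT'
    obtain ⟨T', _, rfl⟩ := mem_image.1 hT'
    exact h ((mem_powersetCard.1 hT).1 (mem_insert_self _ _))

lemma E_erase {s : Finset ι} {a : ι} (h : a ∈ s) (k : ℕ) (x : ι → ℝ) :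
    E s (k+1) x = E (s.erase a) (k+1) x + x a * E (s.erase a) k x := by
  rw [← E_insert (notMem_erase a s), insert_erase h]

lemma euler (s : Finset ι) (k : ℕ) (x : ι → ℝ) :
    ((k:ℝ)+1) * E s (k+1) x = ∑ i ∈ s, x i * E (s.erase i) k x := by
  induction s using Finset.induction_on generalizing k with
  | empty =>
    have : powersetCard (k+1) (∅ : Finset ι) = ∅ := powersetCard_eq_empty.2 (by simp)
    simp [E, this]
  | insert a s ha ih =>
    rw [sum_insert ha, erase_insert ha, E_insert ha]
    have key : ∀ i ∈ s, (insert a s).erase i = insert a (s.erase i) := by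
      intro i hi
      rw [erase_insert_of_ne]
      rintro rfl; exact ha hi
    cases k with
    | zero =>
      have := ih 0
      simp only [E_zero] at this ⊢
      push_cast at *
      linarith
    | succ k =>
      have h1 := ih (k+1)
      have h2 := ih k
      have : ∑ i ∈ s, x i * E ((insert a s).erase i) (k+1) x
        = ∑ i ∈ s, x i * E (s.erase i) (k+1) x + x a * ∑ i ∈ s, x i * E (s.erase i) k x := by
        rw [mul_sum, ← sum_add_distrib]
        refine sum_congr rfl fun i hi => ?_
        rw [key i hi, E_insert (fun hh => ha (mem_of_mem_erase hh))]
        ring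
      rw [this, ← h1, ← h2]
      push_cast
      ring

/-- derivative of a real-rooted polynomial is real-rooted -/
lemma splits_derivative {p : ℝ[X]} (hp : p.Splits) : (derivative p).Splits := by
  by_cases h0 : p.natDegree = 0
  · have : derivative p = 0 := by
      rw [eq_C_of_natDegree_eq_zero h0]; simp
    rw [this]; exact Splits.zero
  rw [splits_iff_card_roots] at *
  have h1 := card_roots_le_derivative p
  have h2 := natDegree_derivative_lt h0
  have h3 := card_roots' (derivative p)
  omega

lemma splits_iter {p : ℝ[X]} (hp : p.Splits) (r : ℕ) : (derivative^[r] p).Splits := by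
  induction r with
  | zero => exact hp
  | succ r ih => rw [Function.iterate_succ_apply']; exact splits_derivative ih

lemma low_coeff {p : ℝ[X]} (hp : p.Splits) : 2 * p.coeff 0 * p.coeff 2 ≤ p.coeff 1 ^ 2 := by
  have key : ∀ s : Multiset ℝ, ∀ c : ℝ, 2 * (C c * (s.map fun a => X - C a).prod).coeff 0 *
      (C c * (s.map fun a => X - C a).prod).coeff 2
        ≤ (C c * (s.map fun a => X - C a).prod).coeff 1 ^ 2 := by
    intro s c
    induction s using Multiset.induction_on with
    | empty => simp [coeff_C]
    | cons a s ih =>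
      rw [Multiset.map_cons, Multiset.prod_cons, mul_left_comm]
      set q := C c * (s.map fun a => X - C a).prod
      have e0 : ((X - C a) * q).coeff 0 = - a * q.coeff 0 := by
        simp [sub_mul]
      have e1 : ((X - C a) * q).coeff 1 = q.coeff 0 - a * q.coeff 1 := by
        simp [sub_mul]
      have e2 : ((X - C a) * q).coeff 2 = q.coeff 1 - a * q.coeff 2 := by
        simp [sub_mul]
      rw [e0, e1, e2]
      nlinarith [mul_le_mul_of_nonneg_left ih (sq_nonneg a), sq_nonneg (q.coeff 0)]
  rw [hp.eq_prod_roots]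
  exact key _ _

lemma newton_coeff {p : ℝ[X]} (hp : p.Splits) (r : ℕ) :
    p.coeff r * p.coeff (r+2) ≤ p.coeff (r+1) ^ 2 := by
  have h := low_coeff (splits_iter hp r)
  simp only [coeff_iterate_derivative, nsmul_eq_mul] at h
  have d0 : (((0 + r).descFactorial r : ℕ) : ℝ) = r.factorial := by simp [Nat.descFactorial_self]
  have d1 : (((1 + r).descFactorial r : ℕ) : ℝ) = (r+1) * r.factorial := by
    have := Nat.factorial_mul_descFactorial (show r ≤ 1 + r by omega)
    rw [show 1 + r - r = 1 by omega, Nat.factorial_one, one_mul, add_comm 1 r,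
      Nat.factorial_succ] at this
    rw [add_comm 1 r, this]; push_cast; ring
  have d2 : 2 * (((2 + r).descFactorial r : ℕ) : ℝ) = (r+2) * ((r+1) * r.factorial) := by
    have := Nat.factorial_mul_descFactorial (show r ≤ 2 + r by omega)
    rw [show 2 + r - r = 2 by omega, Nat.factorial_two, add_comm 2 r,
      Nat.factorial_succ, Nat.factorial_succ] at this
    rw [add_comm 2 r]; exact_mod_cast this
  rw [d0, d1, zero_add, add_comm 1 r, add_comm 2 r] at h
  rw [add_comm 2 r] at d2
  have hf : (0:ℝ) < r.factorial := by exact_mod_cast r.factorial_pos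
  set f : ℝ := (r.factorial : ℝ)
  set a := p.coeff r
  set b := p.coeff (r+1)
  set c := p.coeff (r+2)
  have h' : (f^2 * (r+1)) * ((r+2) * (a * c)) ≤ (f^2 * (r+1)) * ((r+1) * b^2) := by
    calc _ = f * a * (((r+2) * ((r+1) * f)) * c) := by ring
      _ = _ := by rw [← d2]
      _ ≤ ((r+1) * f * b)^2 := by linarith
      _ = _ := by ring
  have h'' := le_of_mul_le_mul_left h' (by positivity)
  have hr : (0:ℝ) ≤ r := Nat.cast_nonneg r
  by_contra hcon
  push Not at hcon
  nlinarith [sq_nonneg b, mul_le_mul_of_nonneg_left hcon.le hr]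

lemma splits_Q (s : Finset ι) (x : ι → ℝ) : (∏ i ∈ s, (X + C (x i))).Splits := by
  apply Splits.prod
  intro i _
  exact Splits.X_add_C _

lemma coeff_Q (s : Finset ι) (x : ι → ℝ) {k : ℕ} (h : k ≤ #s) :
    (∏ i ∈ s, (X + C (x i))).coeff k = E s (#s - k) x := 
  Finset.prod_X_add_C_coeff s x h

lemma E_big (s : Finset ι) (x : ι → ℝ) {k : ℕ} (h : #s < k) : E s k x = 0 := by
  unfold E
  rw [powersetCard_eq_empty.2 h, sum_empty]

lemma newton (s : Finset ι) (x : ι → ℝ) (k : ℕ) :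
    E s k x * E s (k+2) x ≤ E s (k+1) x ^ 2 := by
  by_cases h : k + 2 ≤ #s
  · have := newton_coeff (splits_Q s x) (#s - (k+2))
    rw [coeff_Q _ _ (by omega), coeff_Q _ _ (by omega), coeff_Q _ _ (by omega)] at this
    rw [show #s - (#s - (k+2)) = k+2 by omega, show #s - (#s - (k+2) + 2) = k by omega,
      show #s - (#s - (k+2) + 1) = k+1 by omega] at this
    linarith
  · rw [E_big s x (k := k+2) (by omega)]
    nlinarith [sq_nonneg (E s (k+1) x)]

def G (s : Finset ι) (m : ℕ) (x : ι → ℝ) : Prop := ∀ k ≤ m, 0 < E s k x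

lemma G_erase {s : Finset ι} {m : ℕ} {x : ι → ℝ} (h : G s (m+1) x) {a : ι} (ha : a ∈ s) :
    G (s.erase a) m x := by
  intro k hk
  induction k with
  | zero => rw [E_zero]; norm_num
  | succ k ih =>
    have h0 := ih (by omega)
    by_contra hcon
    push Not at hcon
    have h1 := h (k+1) (by omega)
    have h2 := h (k+1+1) (by omega)
    rw [E_erase ha] at h1 h2
    have hN := newton (s.erase a) x k
    set p := E (s.erase a) k x
    set q := E (s.erase a) (k+1) x
    set r := E (s.erase a) (k+1+1) x
    have hr : - (x a * q) < r := by linarith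
    have hN' : p * r ≤ q^2 := hN
    have := mul_lt_mul_of_pos_left hr h0
    have := mul_nonneg (neg_nonneg.2 hcon) h1.le
    nlinarith

lemma sq_div_ineq {x y s t u : ℝ} (hs : 0 < s) (ht : 0 < t) (hu : s + t ≤ u) :
    (x+y)^2 / u ≤ x^2/s + y^2/t := by
  have h1 : (x+y)^2 / u ≤ (x+y)^2 / (s+t) := by gcongr
  refine h1.trans ?_
  rw [div_add_div _ _ hs.ne' ht.ne', div_le_div_iff₀ (by positivity) (by positivity)]
  nlinarith [mul_nonneg (mul_pos hs ht).le (sq_nonneg (x*t - y*s)), sq_nonneg (x*t - y*s)]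

lemma q_formula {s : Finset ι} {k : ℕ} {x : ι → ℝ} (h : G s (k+1) x) :
    ((k:ℝ)+2) * (E s (k+2) x / E s (k+1) x) =
      ∑ i ∈ s, (x i - x i ^ 2 / (x i + E (s.erase i) (k+1) x / E (s.erase i) k x)) := by
  have he := euler s (k+1) x
  push_cast at he
  rw [← mul_div_assoc, show (k:ℝ)+2 = k+1+1 by ring, he, sum_div]
  refine sum_congr rfl fun i hi => ?_
  have h1 := h (k+1) le_rfl
  have h2 := G_erase h hi k le_rfl
  have h3 := E_erase hi k x
  have h4 : x i + E (s.erase i) (k+1) x / E (s.erase i) k x = E s (k+1) x / E (s.erase i) k x := by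
    rw [h3]; field_simp; ring
  rw [h4]
  have h5 : E (s.erase i) (k+1) x = E s (k+1) x - x i * E (s.erase i) k x := by linarith
  rw [h5]
  field_simp

lemma denom_pos {s : Finset ι} {k : ℕ} {x : ι → ℝ} (h : G s (k+1) x) {i : ι} (hi : i ∈ s) :
    0 < x i + E (s.erase i) (k+1) x / E (s.erase i) k x := by
  have h1 := h (k+1) le_rfl
  have h2 := G_erase h hi k le_rfl
  have h3 := E_erase hi k x
  have h4 : x i + E (s.erase i) (k+1) x / E (s.erase i) k x = E s (k+1) x / E (s.erase i) k x := by
    rw [h3]; field_simp; ring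
  rw [h4]; positivity

lemma E_one (s : Finset ι) (x : ι → ℝ) : E s 1 x = ∑ i ∈ s, x i := by
  simp [E, powersetCard_one]

lemma G_mono {s : Finset ι} {k l : ℕ} {x : ι → ℝ} (h : G s l x) (hkl : k ≤ l) : G s k x :=
  fun j hj => h j (hj.trans hkl)

/-- superadditivity of quotients and convexity of cone -/
lemma quot (k : ℕ) : ∀ (s : Finset ι) (x y : ι → ℝ),
    (G s k x → G s k y → G s k (x+y) ∧ 
      E s (k+1) x / E s k x + E s (k+1) y / E s k y ≤ E s (k+1) (x+y) / E s k (x+y)) := by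
  induction k with
  | zero =>
    intro s x y _ _
    refine ⟨?_, ?_⟩
    · intro j hj
      obtain rfl : j = 0 := by omega
      rw [E_zero]; norm_num
    · simp [E_one, E_zero, sum_add_distrib]
  | succ k ih =>
    intro s x y hx hy
    obtain ⟨hG, hq⟩ := ih s x y (G_mono hx (by omega)) (G_mono hy (by omega))
    have hG' : G s (k+1) (x+y) := by
      intro j hj
      rcases Nat.lt_or_ge j (k+1) with h | h
      · exact hG j (by omega)
      · obtain rfl : j = k+1 := by omega
        have h1 := hx (k+1) le_rfl
        have h2 := hy (k+1) le_rfl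
        have h3 := hx k (by omega)
        have h4 := hy k (by omega)
        have h5 := hG k le_rfl
        have : 0 < E s (k+1) (x+y) / E s k (x+y) := lt_of_lt_of_le (by positivity) hq
        exact (div_pos_iff_of_pos_right h5).1 this
    refine ⟨hG', ?_⟩
    have hk : (0:ℝ) < k + 2 := by positivity
    refine le_of_mul_le_mul_left ?_ hk
    rw [mul_add, q_formula hx, q_formula hy, q_formula hG', ← sum_add_distrib]
    refine sum_le_sum fun i hi => ?_
    have := (ih (s.erase i) x y (G_erase hx hi) (G_erase hy hi)).2
    have h6 := sq_div_ineq (x := x i) (y := y i) (denom_pos hx hi) (denom_pos hy hi)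
      (u := (x+y) i + E (s.erase i) (k+1) (x+y) / E (s.erase i) k (x+y))
      (by rw [Pi.add_apply]; linarith)
    rw [Pi.add_apply] at *
    linarith

lemma E_prod {s : Finset ι} {m : ℕ} {x : ι → ℝ} (h : ∀ k ≤ m, 0 < E s k x) :
    E s m x = ∏ j ∈ range m, (E s (j+1) x / E s j x) := by
  induction m with
  | zero => simp [E_zero]
  | succ m ih =>
    rw [prod_range_succ, ← ih (fun k hk => h k (by omega))]
    have := h m (by omega)
    field_simp

/-- superadditivity of the geometric mean -/
lemma geom {m : ℕ} (hm : 1 ≤ m) (a b c : ℕ → ℝ) (ha : ∀ j, j < m → 0 < a j)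
    (hb : ∀ j, j < m → 0 < b j) (hc : ∀ j, j < m → a j + b j ≤ c j) :
    (∏ j ∈ range m, a j) ^ ((1:ℝ)/m) + (∏ j ∈ range m, b j) ^ ((1:ℝ)/m)
      ≤ (∏ j ∈ range m, c j) ^ ((1:ℝ)/m) := by
  have hm0 : (0:ℝ) < m := by exact_mod_cast hm
  have hcp : ∀ j, j < m → 0 < c j := fun j hj => by linarith [ha j hj, hb j hj, hc j hj]
  have hC : 0 < ∏ j ∈ range m, c j := prod_pos fun j hj => hcp j (mem_range.1 hj)
  have amgm : ∀ z : ℕ → ℝ, (∀ j, j < m → 0 < z j) →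
      (∏ j ∈ range m, z j) ^ ((1:ℝ)/m) / (∏ j ∈ range m, c j) ^ ((1:ℝ)/m)
        ≤ ∑ j ∈ range m, (1/(m:ℝ)) * (z j / c j) := by
    intro z hz
    have h := Real.geom_mean_le_arith_mean_weighted (range m) (fun _ => 1/(m:ℝ))
      (fun j => z j / c j) (fun _ _ => by positivity) (by simp; field_simp)
      (fun j hj => (div_pos (hz j (mem_range.1 hj)) (hcp j (mem_range.1 hj))).le)
    rw [Real.finsetProd_rpow _ _
      (fun j hj => (div_pos (hz j (mem_range.1 hj)) (hcp j (mem_range.1 hj))).le),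
      prod_div_distrib, Real.div_rpow _ hC.le] at h
    · exact h
    · exact (prod_pos fun j hj => hz j (mem_range.1 hj)).le
  have hCr := Real.rpow_pos_of_pos hC ((1:ℝ)/m)
  rw [← div_le_one hCr, add_div]
  refine (add_le_add (amgm a ha) (amgm b hb)).trans ?_
  rw [← sum_add_distrib]
  calc _ ≤ ∑ j ∈ range m, 1/(m:ℝ) := by
        refine sum_le_sum fun j hj => ?_
        have h1 := hcp j (mem_range.1 hj)
        rw [← mul_add, ← add_div]
        have : (a j + b j)/c j ≤ 1 := (div_le_one h1).2 (hc j (mem_range.1 hj))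
        have h2 : (0:ℝ) ≤ 1/m := by positivity
        nlinarith
    _ = 1 := by simp; field_simp

lemma open_super {s : Finset ι} {m : ℕ} (hm : 1 ≤ m) {x y : ι → ℝ} (hx : G s m x) (hy : G s m y) :
    E s m x ^ ((1:ℝ)/m) + E s m y ^ ((1:ℝ)/m) ≤ E s m (x+y) ^ ((1:ℝ)/m) := by
  rw [E_prod hx, E_prod hy, E_prod (quot m s x y hx hy).1]
  refine geom hm _ _ _ ?_ ?_ ?_
  · exact fun j hj => div_pos (hx _ (by omega)) (hx _ (by omega))
  · exact fun j hj => div_pos (hy _ (by omega)) (hy _ (by omega))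
  · exact fun j hj => (quot j s x y (G_mono hx (by omega)) (G_mono hy (by omega))).2


lemma perturb {s : Finset ι} {m : ℕ} (hms : m ≤ #s) {x : ι → ℝ} (h : ∀ k ≤ m, 0 ≤ E s k x)
    {ε : ℝ} (hε : 0 < ε) : G s m (fun i => x i + ε) := by
  intro k hk
  have h1 := coeff_Q s (fun i => x i + ε) (k := #s - k) (by omega)
  rw [show #s - (#s - k) = k by omega] at h1
  rw [← h1]
  have h2 : (∏ i ∈ s, (X + C (x i + ε))) = taylor ε (∏ i ∈ s, (X + C (x i))) := by
    rw [taylor_apply, Polynomial.prod_comp]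
    refine prod_congr rfl fun i _ => ?_
    simp only [add_comp, X_comp, C_comp, C_add]; ring
  rw [h2, taylor_coeff, hasseDeriv_apply, sum_over_range _ (by simp), eval_finsetSum]
  have hdeg : (∏ i ∈ s, (X + C (x i))).natDegree = #s := by
    rw [natDegree_prod_of_monic _ _ (fun i _ => monic_X_add_C _)]
    simp
  rw [hdeg]
  refine sum_pos' ?_ ⟨#s, by simp, ?_⟩
  · intro i hi
    rw [mem_range] at hi
    simp only [eval_monomial]
    rw [coeff_Q _ _ (by omega)]
    by_cases hik : i < #s - k
    · rw [Nat.choose_eq_zero_of_lt hik]; simp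
    · have := h (#s - i) (by omega)
      positivity
  · simp only [eval_monomial]
    rw [coeff_Q _ _ le_rfl, Nat.sub_self, E_zero]
    have : 0 < (#s).choose (#s - k) := Nat.choose_pos (by omega)
    positivity

lemma E_cont (s : Finset ι) (k : ℕ) (x : ι → ℝ) :
    Filter.Tendsto (fun ε : ℝ => E s k (fun i => x i + ε)) (nhdsWithin 0 (Set.Ioi 0))
      (nhds (E s k x)) := by
  have : Continuous (fun ε : ℝ => E s k (fun i => x i + ε)) := by
    unfold E; fun_prop
  have h := this.tendsto 0
  simp only [add_zero] at h
  exact h.mono_left nhdsWithin_le_nhds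

def K (s : Finset ι) (m : ℕ) (x : ι → ℝ) : Prop := ∀ k ≤ m, 0 ≤ E s k x

lemma E_cont2 (s : Finset ι) (k : ℕ) (x y : ι → ℝ) :
    Filter.Tendsto (fun ε : ℝ => E s k ((fun i => x i + ε) + (fun i => y i + ε)))
      (nhdsWithin 0 (Set.Ioi 0)) (nhds (E s k (x+y))) := by
  have : Continuous (fun ε : ℝ => E s k ((fun i => x i + ε) + (fun i => y i + ε))) := by
    unfold E; simp only [Pi.add_apply]; fun_prop
  have h := this.tendsto 0
  simp only [add_zero] at h
  exact h.mono_left nhdsWithin_le_nhds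

lemma K_add {s : Finset ι} {m : ℕ} (hms : m ≤ #s) {x y : ι → ℝ} (hx : K s m x) (hy : K s m y) :
    K s m (x+y) := by
  intro k hk
  refine ge_of_tendsto (E_cont2 s k x y) ?_
  filter_upwards [self_mem_nhdsWithin] with ε hε
  exact ((quot m s _ _ (perturb hms hx hε) (perturb hms hy hε)).1 k hk).le

lemma closed_super {s : Finset ι} {m : ℕ} (hm : 1 ≤ m) (hms : m ≤ #s) {x y : ι → ℝ}
    (hx : K s m x) (hy : K s m y) :
    E s m x ^ ((1:ℝ)/m) + E s m y ^ ((1:ℝ)/m) ≤ E s m (x+y) ^ ((1:ℝ)/m) := by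
  have hp : (0:ℝ) ≤ 1/m := by positivity
  refine le_of_tendsto_of_tendsto
    (((E_cont s m x).rpow_const (Or.inr hp)).add ((E_cont s m y).rpow_const (Or.inr hp)))
    ((E_cont2 s m x y).rpow_const (Or.inr hp)) ?_
  filter_upwards [self_mem_nhdsWithin] with ε hε
  exact open_super hm (perturb hms hx hε) (perturb hms hy hε)

lemma E_smul (s : Finset ι) (k : ℕ) (x : ι → ℝ) (c : ℝ) : E s k (c • x) = c ^ k * E s k x := by
  unfold E
  rw [mul_sum]
  refine sum_congr rfl fun T hT => ?_
  simp only [Pi.smul_apply, smul_eq_mul, prod_mul_distrib, prod_const, (mem_powersetCard.1 hT).2]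

lemma K_smul {s : Finset ι} {m : ℕ} {x : ι → ℝ} (hx : K s m x) {c : ℝ} (hc : 0 ≤ c) :
    K s m (c • x) := by
  intro k hk
  rw [E_smul]
  exact mul_nonneg (pow_nonneg hc k) (hx k hk)

lemma root_smul {s : Finset ι} {m : ℕ} (hm : 1 ≤ m) {x : ι → ℝ} (hx : K s m x) {c : ℝ}
    (hc : 0 ≤ c) : E s m (c • x) ^ ((1:ℝ)/m) = c * E s m x ^ ((1:ℝ)/m) := by
  rw [E_smul, Real.mul_rpow (pow_nonneg hc m) (hx m le_rfl), one_div,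
    Real.pow_rpow_inv_natCast hc (by omega)]

lemma E_perm [Fintype ι] (k : ℕ) (x : ι → ℝ) (σ : Equiv.Perm ι) :
    E univ k (x ∘ σ) = E univ k x := by
  unfold E
  refine sum_bij' (fun T _ => T.map σ.toEmbedding) (fun T _ => T.map σ.symm.toEmbedding)
    ?_ ?_ ?_ ?_ ?_
  · intro T hT; simp only [mem_powersetCard] at *; simp [hT.2]
  · intro T hT; simp only [mem_powersetCard] at *; simp [hT.2]
  · intro T hT; ext i; simp
  · intro T hT; ext i; simp
  · intro T hT; simp

open Matrix in
lemma schur [Fintype ι] {m : ℕ} (hm : 1 ≤ m) (hms : m ≤ Fintype.card ι) {x : ι → ℝ}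
    (hx : K univ m x) {D : Matrix ι ι ℝ} (hD : D ∈ doublyStochastic ℝ ι) :
    K univ m (D *ᵥ x) ∧ E univ m x ^ ((1:ℝ)/m) ≤ E univ m (D *ᵥ x) ^ ((1:ℝ)/m) := by
  have hms' : m ≤ #(univ : Finset ι) := by simpa using hms
  set S : Set (Matrix ι ι ℝ) :=
    {M | K univ m (M *ᵥ x) ∧ E univ m x ^ ((1:ℝ)/m) ≤ E univ m (M *ᵥ x) ^ ((1:ℝ)/m)} with hS
  have hconv : Convex ℝ S := by
    intro M hM N hN a b ha hb hab
    have e : (a • M + b • N) *ᵥ x = a • (M *ᵥ x) + b • (N *ᵥ x) := by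
      rw [add_mulVec, smul_mulVec, smul_mulVec]
    simp only [hS, Set.mem_ofPred_eq] at hM hN ⊢
    rw [e]
    refine ⟨K_add hms' (K_smul hM.1 ha) (K_smul hN.1 hb), ?_⟩
    refine le_trans ?_ (closed_super hm hms' (K_smul hM.1 ha) (K_smul hN.1 hb))
    rw [root_smul hm hM.1 ha, root_smul hm hN.1 hb]
    have h1 := mul_le_mul_of_nonneg_left hM.2 ha
    have h2 := mul_le_mul_of_nonneg_left hN.2 hb
    calc E univ m x ^ ((1:ℝ)/m) = (a+b) * E univ m x ^ ((1:ℝ)/m) := by rw [hab, one_mul]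
      _ ≤ _ := by linarith
  have hD' : D ∈ (doublyStochastic ℝ ι : Set (Matrix ι ι ℝ)) := hD
  rw [doublyStochastic_eq_convexHull_permMatrix] at hD'
  refine convexHull_min ?_ hconv hD'
  rintro _ ⟨σ, rfl⟩
  simp only [hS, Set.mem_ofPred_eq]
  have e : (σ.permMatrix ℝ) *ᵥ x = x ∘ σ := by
    ext i; simp [permMatrix_mulVec]
  rw [e]
  refine ⟨fun k hk => ?_, ?_⟩
  · rw [E_perm]; exact hx k hk
  · rw [E_perm]

open Matrix in
lemma diag_conj {n : ℕ} {A : Matrix (Fin n) (Fin n) ℂ} (hA : A.IsHermitian)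
    (U : Matrix.unitaryGroup (Fin n) ℂ) :
    ∃ D ∈ doublyStochastic ℝ (Fin n), ∀ i,
      ((star (U : Matrix (Fin n) (Fin n) ℂ)) * A * (U : Matrix (Fin n) (Fin n) ℂ)) i i
        = (((D *ᵥ hA.eigenvalues) i : ℝ) : ℂ) := by
  set W : Matrix.unitaryGroup (Fin n) ℂ := star U * hA.eigenvectorUnitary with hW
  have hWW : (W : Matrix (Fin n) (Fin n) ℂ) * star (W : Matrix (Fin n) (Fin n) ℂ) = 1 :=
    Unitary.coe_mul_star_self W
  have hWW' : star (W : Matrix (Fin n) (Fin n) ℂ) * (W : Matrix (Fin n) (Fin n) ℂ) = 1 :=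
    Unitary.coe_star_mul_self W
  refine ⟨Matrix.of fun i j => Complex.normSq ((W : Matrix (Fin n) (Fin n) ℂ) i j), ?_, ?_⟩
  · rw [mem_doublyStochastic_iff_sum]
    simp only [of_apply]
    refine ⟨fun i j => Complex.normSq_nonneg _, fun i => ?_, fun j => ?_⟩
    · have := congrFun (congrFun hWW i) i
      rw [mul_apply, one_apply_eq] at this
      simp only [star_apply, Complex.star_def, Complex.mul_conj] at this
      exact_mod_cast this
    · have := congrFun (congrFun hWW' j) j
      rw [mul_apply, one_apply_eq] at this
      simp only [star_apply, Complex.star_def, ← Complex.normSq_eq_conj_mul_self] at this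
      exact_mod_cast this
  · intro i
    have h := hA.spectral_theorem
    rw [Unitary.conjStarAlgAut_apply] at h
    have e : (star (U : Matrix (Fin n) (Fin n) ℂ)) * A * (U : Matrix (Fin n) (Fin n) ℂ)
        = (W : Matrix (Fin n) (Fin n) ℂ) * diagonal (RCLike.ofReal ∘ hA.eigenvalues)
          * star (W : Matrix (Fin n) (Fin n) ℂ) := by
      conv_lhs => rw [h]
      simp only [hW, Submonoid.coe_mul, Unitary.coe_star, star_mul, star_star, mul_assoc]
    rw [e, mul_apply]
    simp only [mulVec, dotProduct, mul_diagonal, star_apply, Function.comp, of_apply]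
    push_cast
    refine sum_congr rfl fun j _ => ?_
    rw [Complex.normSq_eq_conj_mul_self, Complex.star_def]
    simp only [Complex.coe_algebraMap]
    ring

end SR

/-- Superadditivity of `σ_m^{1/m}` for Hermitian matrices: if `σ_k(A) ≥ 0` and
`σ_k(B) ≥ 0` for every `k = 1,…,m`, then
`σ_m(A+B)^{1/m} ≥ σ_m(A)^{1/m} + σ_m(B)^{1/m}` (nonnegative real `m`-th roots). -/
theorem sigma_root_superadditive {n m : ℕ} (hn : 1 ≤ n) (hm : 1 ≤ m) (hmn : m ≤ n)
    {A B : Matrix (Fin n) (Fin n) ℂ} (hA : A.IsHermitian) (hB : B.IsHermitian)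
    (hσA : ∀ k, 1 ≤ k → k ≤ m → 0 ≤ sigmaH hA k)
    (hσB : ∀ k, 1 ≤ k → k ≤ m → 0 ≤ sigmaH hB k) :
    sigmaH (hA.add hB) m ^ ((1 : ℝ) / m)
      ≥ sigmaH hA m ^ ((1 : ℝ) / m) + sigmaH hB m ^ ((1 : ℝ) / m) := by
  have toE : ∀ {M : Matrix (Fin n) (Fin n) ℂ} (hM : M.IsHermitian) (k : ℕ),
      sigmaH hM k = SR.E Finset.univ k hM.eigenvalues := fun _ _ => rfl
  have KA : SR.K Finset.univ m hA.eigenvalues := by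
    intro k hk
    rcases Nat.eq_zero_or_pos k with rfl | h
    · rw [SR.E_zero]; norm_num
    · exact hσA k h hk
  have KB : SR.K Finset.univ m hB.eigenvalues := by
    intro k hk
    rcases Nat.eq_zero_or_pos k with rfl | h
    · rw [SR.E_zero]; norm_num
    · exact hσB k h hk
  have hcard : m ≤ Fintype.card (Fin n) := by simpa using hmn
  set U := (hA.add hB).eigenvectorUnitary with hU
  obtain ⟨D, hD, hDe⟩ := SR.diag_conj hA U
  obtain ⟨D', hD', hDe'⟩ := SR.diag_conj hB U
  have key : (hA.add hB).eigenvalues = D.mulVec hA.eigenvalues + D'.mulVec hB.eigenvalues := by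
    ext i
    have h := (hA.add hB).conjStarAlgAut_star_eigenvectorUnitary
    rw [Unitary.conjStarAlgAut_star_apply] at h
    have h2 := congrFun (congrFun h i) i
    rw [mul_add, add_mul, Matrix.add_apply] at h2
    have h3 := hDe i
    have h4 := hDe' i
    rw [hU] at h3 h4
    erw [h3, h4] at h2
    rw [Matrix.diagonal_apply_eq] at h2
    rw [Pi.add_apply]
    have h5 : (((D.mulVec hA.eigenvalues i + D'.mulVec hB.eigenvalues i : ℝ)) : ℂ)
        = (((hA.add hB).eigenvalues i : ℝ) : ℂ) := by
      push_cast; exact h2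
    exact (Complex.ofReal_injective h5).symm
  obtain ⟨k1, l1⟩ := SR.schur hm hcard KA hD
  obtain ⟨k2, l2⟩ := SR.schur hm hcard KB hD'
  have := SR.closed_super hm (by simpa using hmn) k1 k2
  rw [toE, toE, toE, key]
  exact le_trans (add_le_add l1 l2) this
end

section
/- Coefficient form of the mixed Hessian inequality: let A and B be n×n complex Hermitian matrices with σ_k(A) ≥ 0 and σ_k(B) ≥ 0 for every k = 1,…,m. The function t ↦ σ_m(A + tB) is a real polynomial in t of degree at most m, say σ_m(A + tB) = Σ_{k=0}^{m} c_k t^k. Then for every k = 0,…,m one has c_k ≥ C(m,k) · σ_m(A)^{(m−k)/m} · σ_m(B)^{k/m}, where C(m,k) is the binomial coefficient and real powers are taken with nonnegative base. -/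
theorem isHermitian_add_smul {n : ℕ} {A B : Matrix (Fin n) (Fin n) ℂ}
    (hA : A.IsHermitian) (hB : B.IsHermitian) (t : ℝ) :
    (A + t • B).IsHermitian := by
  unfold Matrix.IsHermitian
  rw [Matrix.conjTranspose_add, Matrix.conjTranspose_smul, star_trivial, hA.eq, hB.eq]


namespace MixedHessian

open Polynomial

/-- `σ_m` of an arbitrary complex matrix, through the characteristic polynomial. -/
noncomputable def Em {n : ℕ} (m : ℕ) (M : Matrix (Fin n) (Fin n) ℂ) : ℂ :=
  (-1) ^ m * M.charpoly.coeff (n - m)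

/-- The polynomial `τ ↦ σ_m(P + τ Q)`. -/
noncomputable def Qp {n : ℕ} (m : ℕ) (P Q : Matrix (Fin n) (Fin n) ℂ) : ℂ[X] :=
  C ((-1) ^ m) * MvPolynomial.aeval
    (fun ij : Fin n × Fin n => C (Q ij.1 ij.2) * X + C (P ij.1 ij.2))
    ((Matrix.charpoly.univ ℂ (Fin n)).coeff (n - m))

theorem Em_eq_eval {n : ℕ} (m : ℕ) (M : Matrix (Fin n) (Fin n) ℂ) :
    Em m M = (-1) ^ m * MvPolynomial.eval (fun ij : Fin n × Fin n => M ij.1 ij.2)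
      ((Matrix.charpoly.univ ℂ (Fin n)).coeff (n - m)) := by
  have := Matrix.charpoly.univ_coeff_eval₂Hom (Fin n) (RingHom.id ℂ)
    (fun ij : Fin n × Fin n => M ij.1 ij.2) (n - m)
  unfold Em
  rw [show M = Matrix.of (Function.curry (fun ij : Fin n × Fin n => M ij.1 ij.2)) from rfl,
    ← this]
  rfl

theorem Qp_eval {n : ℕ} (m : ℕ) (P Q : Matrix (Fin n) (Fin n) ℂ) (τ : ℂ) :
    (Qp m P Q).eval τ = Em m (P + τ • Q) := by
  rw [Em_eq_eval, Qp, eval_mul, eval_C]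
  congr 1
  rw [← Polynomial.coe_evalRingHom, MvPolynomial.map_aeval, MvPolynomial.eval]
  congr 2
  · ext x <;> simp
  · funext ij
    simp only [coe_evalRingHom, eval_add, eval_mul, eval_C, eval_X, Matrix.add_apply,
      Matrix.smul_apply, smul_eq_mul]
    ring

theorem Em_continuous {n : ℕ} (m : ℕ) :
    Continuous (Em m : Matrix (Fin n) (Fin n) ℂ → ℂ) := by
  have : (Em m : Matrix (Fin n) (Fin n) ℂ → ℂ) = fun M =>
    (-1) ^ m * MvPolynomial.eval (fun ij : Fin n × Fin n => M ij.1 ij.2)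
      ((Matrix.charpoly.univ ℂ (Fin n)).coeff (n - m)) := by
    funext M; exact Em_eq_eval m M
  rw [this]
  refine continuous_const.mul ((MvPolynomial.continuous_eval _).comp ?_)
  exact continuous_pi fun ij => continuous_id.matrix_elem ij.1 ij.2

theorem Em_smul {n m : ℕ} (hmn : m ≤ n) (c : ℂ) (M : Matrix (Fin n) (Fin n) ℂ) :
    Em m (c • M) = c ^ m * Em m M := by
  have h := Matrix.charpoly.univ_coeff_isHomogeneous ℂ (Fin n) (n - m) m (by simp; omega)
  rw [Em_eq_eval, Em_eq_eval]
  rw [MvPolynomial.eval_eq, MvPolynomial.eval_eq, mul_left_comm, Finset.mul_sum (a := c ^ m)]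
  congr 1
  refine Finset.sum_congr rfl fun d hd => ?_
  have hd' : ∑ i, d i = m := by
    have := h (MvPolynomial.mem_support_iff.1 hd)
    rw [Finsupp.weight_apply, Finsupp.sum_fintype] at this
    · simpa using this
    · simp
  have : ∏ i ∈ d.support, (c : ℂ) ^ d i = c ^ m := by
    rw [Finset.prod_pow_eq_pow_sum, ← hd']
    congr 1
    exact Finset.sum_subset (Finset.subset_univ _) (by simp)
  simp only [Matrix.smul_apply, smul_eq_mul, mul_pow, Finset.prod_mul_distrib, this]
  ring

theorem Qp_natDegree {n m : ℕ} (hmn : m ≤ n) (P Q : Matrix (Fin n) (Fin n) ℂ) :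
    (Qp m P Q).natDegree ≤ m := by
  have h := Matrix.charpoly.univ_coeff_isHomogeneous ℂ (Fin n) (n - m) m (by simp; omega)
  refine (natDegree_C_mul_le _ _).trans ?_
  have := MvPolynomial.aeval_natDegree_le _ h.totalDegree_le
    (fun ij : Fin n × Fin n => C (Q ij.1 ij.2) * X + C (P ij.1 ij.2))
    (fun i => natDegree_linear_le)
  simpa using this

theorem Qp_reflect {n m : ℕ} (hmn : m ≤ n) (P Q : Matrix (Fin n) (Fin n) ℂ) :
    Qp m P Q = reflect m (Qp m Q P) := by
  refine Polynomial.eq_of_infinite_eval_eq _ _ ?_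
  refine Set.Infinite.mono (s := {0}ᶜ) ?_ (Set.Finite.infinite_compl (Set.finite_singleton 0))
  intro t ht
  have ht : t ≠ 0 := ht
  have hi := invertibleOfNonzero (inv_ne_zero ht)
  have := eval₂_reflect_mul_pow (RingHom.id ℂ) t⁻¹ m (Qp m Q P) (Qp_natDegree hmn Q P)
  simp only [invOf_eq_inv, inv_inv] at this
  change (reflect m (Qp m Q P)).eval t * _ = (Qp m Q P).eval _ at this
  rw [Qp_eval] at this
  show (Qp m P Q).eval t = (reflect m (Qp m Q P)).eval t
  rw [Qp_eval, show P + t • Q = t • (Q + t⁻¹ • P) by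
    rw [smul_add, smul_smul, mul_inv_cancel₀ ht, one_smul, add_comm], Em_smul hmn, ← this, inv_pow]
  field_simp

theorem Qp_coeff_top {n m : ℕ} (hmn : m ≤ n) (P Q : Matrix (Fin n) (Fin n) ℂ) :
    (Qp m P Q).coeff m = Em m Q := by
  rw [Qp_reflect hmn, coeff_reflect, revAt_le le_rfl, Nat.sub_self, coeff_zero_eq_eval_zero,
    Qp_eval, zero_smul, add_zero]

theorem Qp_coeff_continuous {n : ℕ} (m k : ℕ) :
    Continuous (fun p : Matrix (Fin n) (Fin n) ℂ × Matrix (Fin n) (Fin n) ℂ =>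
      (Qp m p.1 p.2).coeff k) := by
  simp only [Qp, coeff_C_mul]
  refine continuous_const.mul ?_
  generalize (Matrix.charpoly.univ ℂ (Fin n)).coeff (n - m) = φ
  induction φ using MvPolynomial.induction_on generalizing k with
  | C a =>
    simp only [MvPolynomial.aeval_C]
    exact continuous_const
  | add p q hp hq =>
    simp only [map_add, coeff_add]
    exact (hp k).add (hq k)
  | mul_X p i hp =>
    simp only [map_mul, MvPolynomial.aeval_X, mul_add, coeff_add, coeff_mul_C, ← mul_assoc]
    refine Continuous.add ?_ ((hp k).mul (continuous_fst.matrix_elem _ _))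
    cases k with
    | zero => simp only [coeff_mul_X_zero]; exact continuous_const
    | succ k =>
      simp only [coeff_mul_X, coeff_mul_C]
      exact (hp k).mul (continuous_snd.matrix_elem _ _)

/-- Nearby roots. -/
theorem Qp_root_near {n m : ℕ} (hmn : m ≤ n) (hm : 1 ≤ m) (P Q : Matrix (Fin n) (Fin n) ℂ)
    (hQ : Em m Q ≠ 0) (τ : ℂ) (δ : ℝ) (hδ : 0 < δ)
    (h : ‖Em m (P + τ • Q)‖ < ‖Em m Q‖ * δ ^ m) :
    ∃ z, Em m (P + z • Q) = 0 ∧ ‖τ - z‖ < δ := by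
  have hdeg : (Qp m P Q).natDegree = m :=
    le_antisymm (Qp_natDegree hmn P Q) (le_natDegree_of_ne_zero (by rwa [Qp_coeff_top hmn]))
  have hs := IsAlgClosed.splits (Qp m P Q)
  have hne : Qp m P Q ≠ 0 := by
    intro h0; rw [h0] at hdeg; simp at hdeg; omega
  by_contra! hcon
  have hprod := hs.eval_eq_prod_roots τ
  have hcard := splits_iff_card_roots.1 hs
  rw [Qp_eval, leadingCoeff, hdeg, Qp_coeff_top hmn] at hprod
  have : δ ^ m ≤ ‖((Qp m P Q).roots.map (fun a => τ - a)).prod‖ := by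
    have hcm : (Qp m P Q).roots.card = m := hcard.trans hdeg
    have hr : ∀ a ∈ (Qp m P Q).roots, δ ≤ ‖τ - a‖ := by
      intro a ha
      apply hcon
      rw [← Qp_eval]
      exact (mem_roots hne).1 ha
    clear hprod hcard
    generalize (Qp m P Q).roots = s at hr hcm ⊢
    rw [← hcm]
    clear hcm
    induction s using Multiset.induction_on with
    | empty => simp
    | cons a s ih =>
      simp only [Multiset.map_cons, Multiset.prod_cons, norm_mul, Multiset.card_cons, pow_succ]
      rw [mul_comm]
      have h1 := hr a (by simp)
      have h2 := ih (fun b hb => hr b (by simp [hb]))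
      gcongr
  rw [hprod, norm_mul] at h
  have := mul_le_mul_of_nonneg_left this (norm_nonneg (Em m Q))
  linarith

open Filter Topology in
theorem homotopy_real {n m : ℕ} (hmn : m ≤ n) (hm : 1 ≤ m)
    (P : ℝ → Matrix (Fin n) (Fin n) ℂ) (hP : Continuous P) (Q : Matrix (Fin n) (Fin n) ℂ)
    (hQ : Em m Q ≠ 0) (U : Set ℂ) (hU : IsOpen U)
    (hfr : ∀ ε, ∀ z ∈ closure U \ U, Em m (P ε + z • Q) ≠ 0)
    (h0 : ∀ z ∈ U, Em m (P 0 + z • Q) ≠ 0) (ε : ℝ) :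
    ∀ z ∈ U, Em m (P ε + z • Q) ≠ 0 := by
  have hcont : Continuous (fun p : ℝ × ℂ => Em m (P p.1 + p.2 • Q)) :=
    (Em_continuous m).comp ((hP.comp continuous_fst).add (continuous_snd.smul continuous_const))
  have hcont2 : Continuous (fun p : ℝ × ℂ => Em m (p.2 • P p.1 + Q)) :=
    (Em_continuous m).comp ((continuous_snd.smul (hP.comp continuous_fst)).add continuous_const)
  let N : Set ℝ := {ε | ∀ z ∈ U, Em m (P ε + z • Q) ≠ 0}
  have hopen : IsOpen N := by
    rw [isOpen_iff_mem_nhds]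
    intro e he
    have h1 : ∀ᶠ p in 𝓝 ((e, 0) : ℝ × ℂ), Em m (p.2 • P p.1 + Q) ≠ 0 :=
      hcont2.continuousAt.eventually_ne (by simpa using hQ)
    rw [nhds_prod_eq, Metric.nhds_basis_ball.prod Metric.nhds_basis_ball |>.eventually_iff] at h1
    obtain ⟨⟨η₁, η₂⟩, ⟨hη₁, hη₂⟩, h1⟩ := h1
    have hK : IsCompact (closure U ∩ Metric.closedBall (0 : ℂ) η₂⁻¹) :=
      (isCompact_closedBall _ _).inter_left isClosed_closure
    have h2 : ∀ᶠ e' in 𝓝 e, ∀ z ∈ closure U ∩ Metric.closedBall (0 : ℂ) η₂⁻¹,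
        Em m (P e' + z • Q) ≠ 0 := by
      refine hK.eventually_forall_of_forall_eventually fun z hz => ?_
      refine hcont.continuousAt.eventually_ne ?_
      by_cases hzU : z ∈ U
      · exact he z hzU
      · exact hfr e z ⟨hz.1, hzU⟩
    filter_upwards [h2, Metric.ball_mem_nhds e hη₁] with e' h2 he' z hz
    by_cases hzn : ‖z‖ ≤ η₂⁻¹
    · exact h2 z ⟨subset_closure hz, by simpa using hzn⟩
    · push Not at hzn
      have hzpos : 0 < ‖z‖ := lt_trans (inv_pos.2 hη₂) hzn
      have hz0 : z ≠ 0 := norm_pos_iff.1 hzpos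
      have := @h1 (e', z⁻¹) ⟨he', by
        simp only [Metric.mem_ball, dist_zero_right, norm_inv]
        exact inv_lt_of_inv_lt₀ hη₂ hzn⟩
      rw [show P e' + z • Q = z • (z⁻¹ • P e' + Q) by
        rw [smul_add, smul_smul, mul_inv_cancel₀ hz0, one_smul], Em_smul hmn]
      exact mul_ne_zero (pow_ne_zero _ hz0) this
  have hclosed : IsClosed N := by
    rw [← isOpen_compl_iff, isOpen_iff_mem_nhds]
    intro e he
    have he : ∃ z ∈ U, Em m (P e + z • Q) = 0 := by
      by_contra! hcon
      exact he hcon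
    obtain ⟨z, hz, hz0⟩ := he
    obtain ⟨δ, hδ, hball⟩ := Metric.isOpen_iff.1 hU z hz
    have hpos : 0 < ‖Em m Q‖ * δ ^ m := mul_pos (norm_pos_iff.2 hQ) (pow_pos hδ _)
    have hc : Continuous (fun e' => ‖Em m (P e' + z • Q)‖) :=
      (hcont.comp (continuous_id.prodMk continuous_const)).norm
    have : ∀ᶠ e' in 𝓝 e, ‖Em m (P e' + z • Q)‖ < ‖Em m Q‖ * δ ^ m :=
      hc.continuousAt.eventually_lt continuousAt_const (by simpa [hz0] using hpos)
    filter_upwards [this] with e' he'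
    obtain ⟨w, hw, hwz⟩ := Qp_root_near hmn hm (P e') Q hQ z δ hδ he'
    intro hN
    refine hN w (hball ?_) hw
    rw [Metric.mem_ball, dist_comm, dist_eq_norm]
    exact hwz
  have : N = Set.univ := IsClopen.eq_univ ⟨hclosed, hopen⟩ ⟨0, h0⟩
  have h : ε ∈ N := this ▸ Set.mem_univ ε
  exact h

theorem homotopy {n m : ℕ} (hmn : m ≤ n) (hm : 1 ≤ m)
    (P : ℝ → Matrix (Fin n) (Fin n) ℂ) (hP : Continuous P) (Q : Matrix (Fin n) (Fin n) ℂ)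
    (hQ : Em m Q ≠ 0) (U : Set ℂ) (hU : IsOpen U)
    (hfr : ∀ ε, 0 ≤ ε → ε ≤ 1 → ∀ z ∈ closure U \ U, Em m (P ε + z • Q) ≠ 0)
    (h0 : ∀ z ∈ U, Em m (P 0 + z • Q) ≠ 0) :
    ∀ z ∈ U, Em m (P 1 + z • Q) ≠ 0 := by
  have := homotopy_real hmn hm (fun e => P (max 0 (min 1 e))) (hP.comp (by fun_prop)) Q hQ U hU
    (fun e => hfr _ (le_max_left _ _) (by simp)) (by simpa using h0) 1
  simpa using this

/-! ### Hermitian facts -/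

theorem Em_hermitian {n m : ℕ} (hmn : m ≤ n) {A : Matrix (Fin n) (Fin n) ℂ}
    (hA : A.IsHermitian) : Em m A = (sigmaH hA m : ℂ) := by
  rw [Em, hA.charpoly_eq]
  have h := Multiset.prod_X_sub_C_coeff
    (Finset.univ.val.map (fun i => (hA.eigenvalues i : ℂ))) (k := n - m) (by simp)
  rw [Multiset.map_map] at h
  change (∏ i, (X - C (hA.eigenvalues i : ℂ))).coeff (n - m) = _ at h
  erw [h]
  rw [Finset.esymm_map_val]
  simp only [Multiset.card_map, Finset.card_val, Finset.card_univ, Fintype.card_fin,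
    Nat.sub_sub_self hmn, sigmaH]
  rw [← mul_assoc, ← mul_pow]
  push_cast
  simp

theorem Em_add_scalar {n : ℕ} (m : ℕ) (A : Matrix (Fin n) (Fin n) ℂ) (s : ℂ) :
    Em m (A + s • 1) = (-1) ^ m * (hasseDeriv (n - m) A.charpoly).eval (-s) := by
  rw [Em, ← taylor_coeff, taylor_apply, ← Matrix.charpoly_sub_scalar]
  congr 4
  rw [← sub_neg_eq_add A, Matrix.scalar_apply, Matrix.smul_eq_diagonal_mul]
  simp

theorem Em_add_scalar_sum {n m : ℕ} (hmn : m ≤ n) (A : Matrix (Fin n) (Fin n) ℂ) (s : ℂ) :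
    Em m (A + s • 1) = ∑ j ∈ Finset.range (m + 1),
      ((j + (n - m)).choose (n - m) : ℂ) * Em (m - j) A * s ^ j := by
  rw [Em_add_scalar, eval_eq_sum_range' (n := m + 1)]
  · rw [Finset.mul_sum]
    refine Finset.sum_congr rfl fun j hj => ?_
    have hj : j ≤ m := by simpa [Nat.lt_succ_iff] using hj
    rw [hasseDeriv_coeff, Em, show n - (m - j) = j + (n - m) by omega, neg_pow s]
    have : ((-1 : ℂ)) ^ m = (-1) ^ (m - j) * (-1) ^ j := by rw [← pow_add]; congr 1; omega
    rw [this]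
    have h2 : ((-1 : ℂ)) ^ j * (-1) ^ j = 1 := by rw [← mul_pow]; simp
    linear_combination ((-1 : ℂ) ^ (m - j) * ((j + (n - m)).choose (n - m) : ℂ) *
      A.charpoly.coeff (j + (n - m)) * s ^ j) * h2
  · have := natDegree_hasseDeriv_le A.charpoly (n - m)
    rw [Matrix.charpoly_natDegree_eq_dim, Fintype.card_fin] at this
    omega

theorem Em_zero {n : ℕ} (A : Matrix (Fin n) (Fin n) ℂ) : Em 0 A = 1 := by
  have := A.charpoly_monic.coeff_natDegree
  rw [Matrix.charpoly_natDegree_eq_dim, Fintype.card_fin] at this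
  simp [Em, this]

theorem real_roots_iterate (p : ℂ[X]) (hp : ∀ z, p.eval z = 0 → z.im = 0) (k : ℕ)
    (hk : k ≤ p.natDegree) (hp0 : p ≠ 0) :
    ∀ z, (derivative^[k] p).eval z = 0 → z.im = 0 := by
  induction k with
  | zero => simpa using hp
  | succ k ih =>
    intro z hz
    have ih := ih (by omega)
    have hdeg : (derivative^[k] p).natDegree = p.natDegree - k := by
      rw [← factorial_smul_hasseDeriv, LinearMap.smul_apply,
        natDegree_smul_of_smul_regular _ (fun x y h => by simpa [Nat.factorial_ne_zero] using h),
        natDegree_hasseDeriv]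
    have hpos : 0 < (derivative^[k] p).degree := by
      rw [← natDegree_pos_iff_degree_pos]; omega
    rw [Function.iterate_succ_apply'] at hz
    have hne : derivative (derivative^[k] p) ≠ 0 := by
      intro h0
      have := derivative_eq_zero.1 h0
      omega
    have hmem : z ∈ (derivative (derivative^[k] p)).rootSet ℂ := by
      rw [mem_rootSet]; exact ⟨hne, by simpa using hz⟩
    have := rootSet_derivative_subset_convexHull_rootSet hpos hmem
    have hconv : Convex ℝ {z : ℂ | z.im = 0} := by
      intro x hx y hy a b _ _ _
      simp only [Set.mem_ofPred_eq] at *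
      simp [hx, hy]
    refine convexHull_min ?_ hconv this
    intro w hw
    rw [mem_rootSet] at hw
    exact ih w (by simpa using hw.2)

theorem Em_real_root {n m : ℕ} {A : Matrix (Fin n) (Fin n) ℂ}
    (hA : A.IsHermitian) (s : ℂ) (hs : Em m (A + s • 1) = 0) : s.im = 0 := by
  rw [Em_add_scalar] at hs
  have hs : (hasseDeriv (n - m) A.charpoly).eval (-s) = 0 := by simpa using hs
  have h1 : (derivative^[n - m] A.charpoly).eval (-s) = 0 := by
    rw [← factorial_smul_hasseDeriv]
    simp [hs]
  have := real_roots_iterate A.charpoly ?_ (n - m) ?_ A.charpoly_monic.ne_zero _ h1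
  · simpa using this
  · intro z hz
    rw [hA.charpoly_eq, eval_prod, Finset.prod_eq_zero_iff] at hz
    obtain ⟨i, _, hi⟩ := hz
    have : z = hA.eigenvalues i := by simpa [sub_eq_zero] using hi
    simp [this]
  · rw [Matrix.charpoly_natDegree_eq_dim, Fintype.card_fin]; omega

theorem Em_im {n m : ℕ} (hmn : m ≤ n) {A : Matrix (Fin n) (Fin n) ℂ}
    (hA : A.IsHermitian) : (Em m A).im = 0 := by
  rw [Em_hermitian hmn hA]; simp

theorem herm_real_smul {n : ℕ} {A : Matrix (Fin n) (Fin n) ℂ} (hA : A.IsHermitian) (x : ℝ) :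
    ((x : ℂ) • A).IsHermitian := by
  unfold Matrix.IsHermitian
  rw [Matrix.conjTranspose_smul, hA.eq]
  simp

theorem Em_pos_scalar {n m : ℕ} (hmn : m ≤ n) {A : Matrix (Fin n) (Fin n) ℂ}
    (hA : ∀ k ≤ m, 0 ≤ (Em k A).re) (s : ℝ) (hs : 0 < s) :
    0 < (Em m (A + (s : ℂ) • 1)).re := by
  rw [Em_add_scalar_sum hmn, Complex.re_sum]
  have hterm : ∀ j, (((j + (n - m)).choose (n - m) : ℂ) * Em (m - j) A * (s : ℂ) ^ j).re
      = ((j + (n - m)).choose (n - m) : ℝ) * (Em (m - j) A).re * s ^ j := by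
    intro j
    rw [← Complex.ofReal_pow, Complex.re_mul_ofReal, ← Complex.ofReal_natCast,
      Complex.re_ofReal_mul]
  simp only [hterm]
  refine Finset.sum_pos' (fun j _ => ?_) ⟨m, by simp, ?_⟩
  · have := hA (m - j) (by omega)
    positivity
  · simp only [Nat.sub_self, Em_zero, Complex.one_re, mul_one]
    have : 0 < (m + (n - m)).choose (n - m) := Nat.choose_pos (by omega)
    positivity

theorem upper_scalar {n m : ℕ} (hmn : m ≤ n) (hm : 1 ≤ m) {A B : Matrix (Fin n) (Fin n) ℂ}
    (hA : A.IsHermitian) (hB : B.IsHermitian) (hBp : ∀ k ≤ m, 0 < (Em k B).re)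
    (z : ℂ) (hz : 0 < z.im) : Em m (A + Complex.I • 1 + z • B) ≠ 0 := by
  have hB0 : Em m B ≠ 0 := by
    intro h; have := hBp m le_rfl; simp [h] at this
  have := homotopy hmn hm (fun e : ℝ => (e : ℂ) • A + Complex.I • 1)
    (by fun_prop) B hB0 {z | 0 < z.im} (isOpen_lt continuous_const Complex.continuous_im) ?_ ?_ z hz
  · simpa using this
  · intro e _ _ w hw h
    rw [Complex.closure_setOfPred_lt_im] at hw
    have hw0 : w.im = 0 := le_antisymm (not_lt.1 hw.2) hw.1
    have hw' : w = (w.re : ℂ) := by apply Complex.ext <;> simp [hw0]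
    rw [hw', add_right_comm] at h
    have := Em_real_root ((herm_real_smul hA e).add (herm_real_smul hB w.re)) _ h
    simp at this
  · intro w hw h
    have hw : 0 < w.im := hw
    have hw0 : w ≠ 0 := by rintro rfl; simp at hw
    simp only [Complex.ofReal_zero, zero_smul, zero_add] at h
    rw [show Complex.I • (1 : Matrix (Fin n) (Fin n) ℂ) + w • B
      = w • (B + (w⁻¹ * Complex.I) • 1) by
        rw [smul_add, smul_smul, mul_inv_cancel_left₀ hw0, add_comm], Em_smul hmn] at h
    have h := (mul_eq_zero.1 h).resolve_left (pow_ne_zero _ hw0)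
    have him := Em_real_root hB _ h
    set s := w⁻¹ * Complex.I with hs
    have hs' : s = (s.re : ℂ) := by apply Complex.ext <;> simp [him]
    have hsw : w * s = Complex.I := by rw [hs, mul_inv_cancel_left₀ hw0]
    have h1 : w.im * s.re = 1 := by
      have := congrArg Complex.im hsw
      rw [Complex.mul_im, him] at this
      simpa using this
    have hspos : 0 < s.re := by
      by_contra hcon
      nlinarith
    have := Em_pos_scalar hmn (fun k hk => (hBp k hk).le) s.re hspos
    rw [← hs', h] at this
    simp at this

theorem upper {n m : ℕ} (hmn : m ≤ n) (hm : 1 ≤ m) {A B : Matrix (Fin n) (Fin n) ℂ}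
    (hA : A.IsHermitian) (hB : B.IsHermitian) (hBp : ∀ k ≤ m, 0 < (Em k B).re)
    (z : ℂ) (hz : 0 < z.im) : Em m (A + z • B) ≠ 0 := by
  intro h0
  have hB0 : Em m B ≠ 0 := by
    intro h; have := hBp m le_rfl; simp [h] at this
  have hδ : ∀ δ : ℝ, 0 < δ → ∀ w : ℂ, 0 < w.im →
      Em m (A + ((δ : ℂ) * Complex.I) • 1 + w • B) ≠ 0 := by
    intro δ hδ w hw
    have hδ0 : (δ : ℂ) ≠ 0 := by exact_mod_cast hδ.ne'
    rw [show A + ((δ : ℂ) * Complex.I) • (1 : Matrix (Fin n) (Fin n) ℂ) + w • B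
      = (δ : ℂ) • (((δ⁻¹ : ℝ) : ℂ) • A + Complex.I • 1 + (((δ⁻¹ : ℝ) : ℂ) * w) • B) by
        simp only [smul_add, smul_smul, ← mul_assoc, Complex.ofReal_inv,
          mul_inv_cancel₀ hδ0, one_smul, one_mul], Em_smul hmn]
    refine mul_ne_zero (pow_ne_zero _ hδ0) (upper_scalar hmn hm (herm_real_smul hA _) hB hBp _ ?_)
    rw [Complex.im_ofReal_mul]
    positivity
  have hc : Continuous (fun δ : ℝ => ‖Em m (A + ((δ : ℂ) * Complex.I) • 1 + z • B)‖) :=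
    ((Em_continuous m).comp (by fun_prop)).norm
  have hpos : 0 < ‖Em m B‖ * z.im ^ m := mul_pos (norm_pos_iff.2 hB0) (pow_pos hz _)
  have hev := (hc.tendsto 0).eventually_lt_const (by simpa [h0] using hpos)
  obtain ⟨η, hη, hball⟩ := Metric.eventually_nhds_iff.1 hev
  have := hball (y := η / 2) (by simp [abs_of_pos hη]; linarith)
  obtain ⟨w, hw, hwz⟩ := Qp_root_near hmn hm _ B hB0 z z.im hz this
  refine hδ (η / 2) (by linarith) w ?_ hw
  have := (Complex.abs_im_le_norm (z - w)).trans_lt hwz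
  rw [Complex.sub_im, abs_lt] at this
  linarith [this.2]

theorem real_rooted {n m : ℕ} (hmn : m ≤ n) (hm : 1 ≤ m) {A B : Matrix (Fin n) (Fin n) ℂ}
    (hA : A.IsHermitian) (hB : B.IsHermitian) (hBp : ∀ k ≤ m, 0 < (Em k B).re)
    (z : ℂ) (h : Em m (A + z • B) = 0) : z.im = 0 := by
  rcases lt_trichotomy z.im 0 with hz | hz | hz
  · exfalso
    refine upper hmn hm hA.neg hB hBp (-z) (by simpa using hz) ?_
    rw [show -A + (-z) • B = (-1 : ℂ) • (A + z • B) by simp [smul_add], Em_smul hmn, h, mul_zero]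
  · exact hz
  · exact absurd h (upper hmn hm hA hB hBp z hz)

theorem neg_rooted {n m : ℕ} (hmn : m ≤ n) (hm : 1 ≤ m) {A B : Matrix (Fin n) (Fin n) ℂ}
    (hA : A.IsHermitian) (hB : B.IsHermitian) (hAp : ∀ k ≤ m, 0 < (Em k A).re)
    (hBp : ∀ k ≤ m, 0 < (Em k B).re)
    (z : ℂ) (h : Em m (A + z • B) = 0) : z.im = 0 ∧ z.re < 0 := by
  have hzim := real_rooted hmn hm hA hB hBp z h
  refine ⟨hzim, ?_⟩
  have hB0 : Em m B ≠ 0 := by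
    intro h; have := hBp m le_rfl; simp [h] at this
  have hA0 : Em m A ≠ 0 := by
    intro h; have := hAp m le_rfl; simp [h] at this
  by_contra hcon
  rcases (not_lt.1 hcon).eq_or_lt with h0 | hpos
  · have : z = 0 := by apply Complex.ext <;> simp [hzim, ← h0]
    rw [this, zero_smul, add_zero] at h
    exact hA0 h
  have := homotopy hmn hm (fun e : ℝ => (e : ℂ) • A + ((1 - e : ℝ) : ℂ) • 1)
    (by fun_prop) B hB0 {z | 0 < z.re} (isOpen_lt continuous_const Complex.continuous_re)
    ?_ ?_ z hpos
  · simp [h] at this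
  · intro e he0 he1 w hw h
    rw [Complex.closure_setOfPred_lt_re] at hw
    have hw0 : w.re = 0 := le_antisymm (not_lt.1 hw.2) hw.1
    have hw1 := real_rooted hmn hm ((herm_real_smul hA e).add
      (herm_real_smul Matrix.isHermitian_one (1 - e))) hB hBp w h
    have : w = 0 := by apply Complex.ext <;> simp [hw0, hw1]
    rw [this, zero_smul, add_zero] at h
    rcases he1.eq_or_lt with rfl | he1
    · simp at h; exact hA0 h
    · have := Em_pos_scalar hmn (A := (e : ℂ) • A) (fun k hk => ?_) (1 - e) (by linarith)
      · rw [h] at this; simp at this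
      · rw [Em_smul (hk.trans hmn), ← Complex.ofReal_pow, Complex.re_ofReal_mul]
        have := hAp k hk
        positivity
  · intro w hw h
    have hw : 0 < w.re := hw
    have hw0 : w ≠ 0 := by rintro rfl; simp at hw
    simp only [Complex.ofReal_zero, zero_smul, zero_add, sub_zero, Complex.ofReal_one,
      one_smul] at h
    rw [show (1 : Matrix (Fin n) (Fin n) ℂ) + w • B = w • (B + w⁻¹ • 1) by
        rw [smul_add, smul_smul, mul_inv_cancel₀ hw0, add_comm, one_smul], Em_smul hmn] at h
    have h := (mul_eq_zero.1 h).resolve_left (pow_ne_zero _ hw0)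
    have him := Em_real_root hB _ h
    have hs' : w⁻¹ = (w⁻¹.re : ℂ) := by
      apply Complex.ext
      · simp
      · rw [him]; simp
    have hspos : 0 < w⁻¹.re := by
      rw [Complex.inv_re]
      exact div_pos hw (Complex.normSq_pos.2 hw0)
    have := Em_pos_scalar hmn (fun k hk => (hBp k hk).le) w⁻¹.re hspos
    rw [← hs', h] at this
    simp at this

/-! ### Elementary symmetric means -/

theorem sum_powersetCard_sum {m : ℕ} (hm : 1 ≤ m) (j : ℕ) (x : Fin m → ℝ) :
    ∑ S ∈ Finset.powersetCard j (Finset.univ : Finset (Fin m)), ∑ i ∈ S, x i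
      = (m.choose j : ℝ) * ((j : ℝ) / m) * ∑ i, x i := by
  have hcount : ∀ i : Fin m, (((Finset.powersetCard j (Finset.univ : Finset (Fin m))).filter
      (fun S => i ∈ S)).card : ℝ) = (m.choose j : ℝ) * ((j : ℝ) / m) := by
    intro i
    have h1 : (Finset.powersetCard j (Finset.univ : Finset (Fin m))).filter (fun S => i ∉ S)
        = Finset.powersetCard j (Finset.univ.erase i) := by
      ext S
      simp only [Finset.mem_filter, Finset.mem_powersetCard, Finset.subset_univ, true_and]
      constructor
      · rintro ⟨h1, h2⟩
        exact ⟨fun a ha => Finset.mem_erase.2 ⟨fun h => h2 (h ▸ ha), Finset.mem_univ _⟩, h1⟩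
      · rintro ⟨h1, h2⟩
        exact ⟨h2, fun h => by simpa using h1 h⟩
    have h2 := Finset.card_filter_add_card_filter_not
      (s := Finset.powersetCard j (Finset.univ : Finset (Fin m))) (fun S => i ∈ S)
    rw [h1, Finset.card_powersetCard, Finset.card_powersetCard, Finset.card_erase_of_mem
      (Finset.mem_univ _), Finset.card_univ, Fintype.card_fin] at h2
    obtain ⟨m, rfl⟩ : ∃ m', m = m' + 1 := ⟨m - 1, by omega⟩
    simp only [Nat.add_sub_cancel] at h2
    generalize ((Finset.powersetCard j (Finset.univ : Finset (Fin (m + 1)))).filter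
      (fun S => i ∈ S)).card = N at h2 ⊢
    cases j with
    | zero => simp at h2 ⊢; exact h2
    | succ j =>
      rw [Nat.choose_succ_succ'] at h2
      have hN : N = m.choose j := by omega
      have h3 := Nat.add_one_mul_choose_eq m j
      rw [hN]
      have h4 : ((m + 1 : ℕ) : ℝ) * (m.choose j : ℝ)
        = ((m + 1).choose (j + 1) : ℝ) * ((j + 1 : ℕ) : ℝ) := by exact_mod_cast h3
      have h5 : ((m + 1 : ℕ) : ℝ) ≠ 0 := by positivity
      field_simp
      linarith
  calc _ = ∑ S ∈ Finset.powersetCard j (Finset.univ : Finset (Fin m)), ∑ i,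
        (if i ∈ S then x i else 0) := by
        refine Finset.sum_congr rfl fun S _ => ?_
        rw [Finset.sum_ite_mem, Finset.univ_inter]
    _ = ∑ i, ∑ S ∈ Finset.powersetCard j (Finset.univ : Finset (Fin m)),
        (if i ∈ S then x i else 0) := Finset.sum_comm
    _ = ∑ i, (m.choose j : ℝ) * ((j : ℝ) / m) * x i := by
        refine Finset.sum_congr rfl fun i _ => ?_
        rw [← Finset.sum_filter, Finset.sum_const, nsmul_eq_mul, hcount]
    _ = _ := by rw [Finset.mul_sum]

theorem esymm_ge {m : ℕ} (hm : 1 ≤ m) (j : ℕ) (r : Fin m → ℝ) (hr : ∀ i, 0 < r i) :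
    (m.choose j : ℝ) * (∏ i, r i) ^ ((j : ℝ) / m)
      ≤ ∑ S ∈ Finset.powersetCard j (Finset.univ : Finset (Fin m)), ∏ i ∈ S, r i := by
  set G := (∏ i, r i) ^ ((j : ℝ) / m) with hG
  have hprod : 0 < ∏ i, r i := Finset.prod_pos fun i _ => hr i
  have hGpos : 0 < G := Real.rpow_pos_of_pos hprod _
  have hlogG : Real.log G = ((j : ℝ) / m) * ∑ i, Real.log (r i) := by
    rw [hG, Real.log_rpow hprod, Real.log_prod (fun i _ => (hr i).ne')]
  have hS : ∀ S ∈ Finset.powersetCard j (Finset.univ : Finset (Fin m)),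
      G * (1 + (∑ i ∈ S, Real.log (r i) - Real.log G)) ≤ ∏ i ∈ S, r i := by
    intro S _
    have hp : 0 < ∏ i ∈ S, r i := Finset.prod_pos fun i _ => hr i
    rw [← Real.log_prod (fun i _ => (hr i).ne'), ← Real.log_div hp.ne' hGpos.ne']
    have := Real.log_le_sub_one_of_pos (div_pos hp hGpos)
    have h2 : 1 + Real.log ((∏ i ∈ S, r i) / G) ≤ (∏ i ∈ S, r i) / G := by linarith
    calc _ ≤ G * ((∏ i ∈ S, r i) / G) := by gcongr
      _ = _ := by field_simp
  refine le_trans (le_of_eq ?_) (Finset.sum_le_sum hS)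
  rw [← Finset.mul_sum, Finset.sum_add_distrib, Finset.sum_sub_distrib, sum_powersetCard_sum hm,
    Finset.sum_const, Finset.sum_const, Finset.card_powersetCard, Finset.card_univ,
    Fintype.card_fin, hlogG]
  simp only [nsmul_eq_mul]
  ring

theorem exists_fin_enum {α : Type*} (s : Multiset α) :
    ∃ r : Fin s.card → α, Finset.univ.val.map r = s := by
  induction s using Quotient.inductionOn with
  | h l =>
    refine ⟨fun i => l.get i, ?_⟩
    rw [Fin.univ_val_map]
    simp

theorem coeff_ineq {n m : ℕ} (hmn : m ≤ n) (hm : 1 ≤ m) {A B : Matrix (Fin n) (Fin n) ℂ}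
    (hA : A.IsHermitian) (hB : B.IsHermitian) (hAp : ∀ k ≤ m, 0 < (Em k A).re)
    (hBp : ∀ k ≤ m, 0 < (Em k B).re) (k : ℕ) (hk : k ≤ m) :
    (m.choose k : ℝ) * (Em m A).re ^ (((m - k : ℕ) : ℝ) / m) * (Em m B).re ^ ((k : ℝ) / m)
      ≤ ((Qp m A B).coeff k).re := by
  have hB0 : Em m B ≠ 0 := by
    intro h; have := hBp m le_rfl; simp [h] at this
  have hdeg : (Qp m A B).natDegree = m :=
    le_antisymm (Qp_natDegree hmn A B) (le_natDegree_of_ne_zero (by rwa [Qp_coeff_top hmn]))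
  have hs := IsAlgClosed.splits (Qp m A B)
  have hne : Qp m A B ≠ 0 := by
    intro h0; rw [h0] at hdeg; simp at hdeg; omega
  have hcard : (Qp m A B).roots.card = m := (splits_iff_card_roots.1 hs).trans hdeg
  obtain ⟨ρ, hρ⟩ : ∃ ρ : Fin m → ℂ, Finset.univ.val.map ρ = (Qp m A B).roots := by
    have := exists_fin_enum (Qp m A B).roots
    rwa [hcard] at this
  have hroot : ∀ i, (ρ i).im = 0 ∧ (ρ i).re < 0 := by
    intro i
    refine neg_rooted hmn hm hA hB hAp hBp _ ?_
    rw [← Qp_eval]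
    refine (mem_roots hne).1 ?_
    rw [← hρ]
    exact Multiset.mem_map_of_mem _ (Finset.mem_univ i)
  set r : Fin m → ℝ := fun i => -(ρ i).re with hr
  have hrpos : ∀ i, 0 < r i := fun i => by simpa [hr] using (hroot i).2
  have hρr : ∀ i, ρ i = -(r i : ℂ) := by
    intro i
    apply Complex.ext <;> simp [hr, (hroot i).1]
  set b := (Em m B).re with hb
  have hbB : Em m B = (b : ℂ) := by apply Complex.ext <;> simp [hb, Em_im hmn hB]
  have hfact : Qp m A B = C (b : ℂ) * ∏ i, (X + C (r i : ℂ)) := by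
    have := hs.eq_prod_roots
    rw [leadingCoeff, hdeg, Qp_coeff_top hmn, hbB, ← hρ, Multiset.map_map] at this
    rw [this]
    congr 1
    change ∏ i, (X - C (ρ i)) = _
    refine Finset.prod_congr rfl fun i _ => ?_
    rw [hρr, C_neg, sub_neg_eq_add]
  have hcoeff : ((Qp m A B).coeff k).re
      = b * ∑ S ∈ Finset.powersetCard (m - k) (Finset.univ : Finset (Fin m)), ∏ i ∈ S, r i := by
    rw [hfact, coeff_C_mul, Finset.prod_X_add_C_coeff _ _ (by simpa using hk), Finset.card_univ,
      Fintype.card_fin, Complex.re_ofReal_mul]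
    congr 1
    have : ∑ S ∈ Finset.powersetCard (m - k) (Finset.univ : Finset (Fin m)), ∏ i ∈ S, (r i : ℂ)
      = ((∑ S ∈ Finset.powersetCard (m - k) (Finset.univ : Finset (Fin m)), ∏ i ∈ S, r i : ℝ) : ℂ)
      := by push_cast; rfl
    rw [this, Complex.ofReal_re]
  have ha : (Em m A).re = b * ∏ i, r i := by
    have h1 := Qp_eval m A B 0
    rw [zero_smul, add_zero, hfact] at h1
    rw [← h1]
    simp only [eval_mul, eval_C, eval_prod, eval_add, eval_X, zero_add]
    rw [← Complex.ofReal_prod, Complex.re_ofReal_mul, Complex.ofReal_re]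
  have hbpos : 0 < b := hBp m le_rfl
  have hprod : 0 < ∏ i, r i := Finset.prod_pos fun i _ => hrpos i
  rw [hcoeff, ha, Real.mul_rpow hbpos.le hprod.le]
  have hm0 : (m : ℝ) ≠ 0 := by positivity
  have hbb : b ^ (((m - k : ℕ) : ℝ) / m) * b ^ ((k : ℝ) / m) = b := by
    rw [← Real.rpow_add hbpos, Nat.cast_sub hk, ← add_div, sub_add_cancel, div_self hm0,
      Real.rpow_one]
  have hes := esymm_ge hm (m - k) r hrpos
  rw [Nat.choose_symm hk] at hes
  calc _ = (b ^ (((m - k : ℕ) : ℝ) / m) * b ^ ((k : ℝ) / m)) *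
        ((m.choose k : ℝ) * (∏ i, r i) ^ (((m - k : ℕ) : ℝ) / m)) := by ring
    _ ≤ _ := by rw [hbb]; gcongr

theorem coeff_ineq_closed {n m : ℕ} (hmn : m ≤ n) (hm : 1 ≤ m) {A B : Matrix (Fin n) (Fin n) ℂ}
    (hA : A.IsHermitian) (hB : B.IsHermitian) (hAp : ∀ k ≤ m, 0 ≤ (Em k A).re)
    (hBp : ∀ k ≤ m, 0 ≤ (Em k B).re) (k : ℕ) (hk : k ≤ m) :
    (m.choose k : ℝ) * (Em m A).re ^ (((m - k : ℕ) : ℝ) / m) * (Em m B).re ^ ((k : ℝ) / m)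
      ≤ ((Qp m A B).coeff k).re := by
  have hcA : Continuous (fun e : ℝ => A + (e : ℂ) • (1 : Matrix (Fin n) (Fin n) ℂ)) := by fun_prop
  have hcB : Continuous (fun e : ℝ => B + (e : ℂ) • (1 : Matrix (Fin n) (Fin n) ℂ)) := by fun_prop
  have hL : Continuous (fun e : ℝ => (m.choose k : ℝ)
      * (Em m (A + (e : ℂ) • 1)).re ^ (((m - k : ℕ) : ℝ) / m)
      * (Em m (B + (e : ℂ) • 1)).re ^ ((k : ℝ) / m)) := by
    refine (continuous_const.mul ?_).mul ?_
    · exact Continuous.rpow_const (f := fun e : ℝ => (Em m (A + (e : ℂ) • 1)).re)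
        (Complex.continuous_re.comp ((Em_continuous m).comp hcA))
        (fun _ => Or.inr (div_nonneg (Nat.cast_nonneg _) (Nat.cast_nonneg _)))
    · exact Continuous.rpow_const (f := fun e : ℝ => (Em m (B + (e : ℂ) • 1)).re)
        (Complex.continuous_re.comp ((Em_continuous m).comp hcB))
        (fun _ => Or.inr (div_nonneg (Nat.cast_nonneg _) (Nat.cast_nonneg _)))
  have hR : Continuous (fun e : ℝ =>
      ((Qp m (A + (e : ℂ) • 1) (B + (e : ℂ) • 1)).coeff k).re) :=
    Complex.continuous_re.comp (g := Complex.re)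
      (f := fun e : ℝ => (Qp m (A + (e : ℂ) • 1) (B + (e : ℂ) • 1)).coeff k)
      (Continuous.comp (f := fun e : ℝ => (A + (e : ℂ) • (1 : Matrix (Fin n) (Fin n) ℂ),
        B + (e : ℂ) • (1 : Matrix (Fin n) (Fin n) ℂ))) (Qp_coeff_continuous m k)
        (hcA.prodMk hcB))
  have hlim := le_of_tendsto_of_tendsto (b := nhdsWithin (0 : ℝ) (Set.Ioi 0))
    ((hL.tendsto 0).mono_left nhdsWithin_le_nhds) ((hR.tendsto 0).mono_left nhdsWithin_le_nhds) ?_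
  · simpa using hlim
  · filter_upwards [self_mem_nhdsWithin] with e he
    have he : 0 < e := he
    refine coeff_ineq hmn hm (hA.add (herm_real_smul Matrix.isHermitian_one e))
      (hB.add (herm_real_smul Matrix.isHermitian_one e)) ?_ ?_ k hk
    · intro j hj
      exact Em_pos_scalar (hj.trans hmn) (fun i hi => hAp i (hi.trans hj)) e he
    · intro j hj
      exact Em_pos_scalar (hj.trans hmn) (fun i hi => hBp i (hi.trans hj)) e he

end MixedHessian

/-- Coefficient form of the mixed Hessian inequality: if `σ_k(A) ≥ 0` and `σ_k(B) ≥ 0`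
for every `k = 1,…,m`, and `σ_m(A + tB) = ∑_{k=0}^{m} c_k t^k` for all real `t`
(the map `t ↦ σ_m(A+tB)` is a real polynomial of degree at most `m`), then for every
`k = 0,…,m` one has `c_k ≥ C(m,k) σ_m(A)^{(m−k)/m} σ_m(B)^{k/m}`. -/
theorem mixed_hessian_coefficient_inequality {n m : ℕ} (hn : 1 ≤ n) (hm : 1 ≤ m)
    (hmn : m ≤ n) {A B : Matrix (Fin n) (Fin n) ℂ}
    (hA : A.IsHermitian) (hB : B.IsHermitian)
    (hσA : ∀ k, 1 ≤ k → k ≤ m → 0 ≤ sigmaH hA k)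
    (hσB : ∀ k, 1 ≤ k → k ≤ m → 0 ≤ sigmaH hB k)
    (c : ℕ → ℝ)
    (hc : ∀ t : ℝ, sigmaH (isHermitian_add_smul hA hB t) m
        = ∑ k ∈ Finset.range (m + 1), c k * t ^ k) :
    ∀ k ≤ m, c k ≥ (m.choose k : ℝ)
        * sigmaH hA m ^ (((m - k : ℕ) : ℝ) / m)
        * sigmaH hB m ^ ((k : ℝ) / m) := by

  intro k hk
  have hnn : ∀ {M : Matrix (Fin n) (Fin n) ℂ} (hM : M.IsHermitian),
      (∀ k, 1 ≤ k → k ≤ m → 0 ≤ sigmaH hM k) → ∀ k ≤ m, 0 ≤ (MixedHessian.Em k M).re := by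
    intro M hM h j hj
    rcases Nat.eq_zero_or_pos j with rfl | hj0
    · simp [MixedHessian.Em_zero]
    · rw [MixedHessian.Em_hermitian (hj.trans hmn) hM, Complex.ofReal_re]
      exact h j hj0 hj
  have main := MixedHessian.coeff_ineq_closed hmn hm hA hB (hnn hA hσA) (hnn hB hσB) k hk
  rw [MixedHessian.Em_hermitian hmn hA, MixedHessian.Em_hermitian hmn hB, Complex.ofReal_re, Complex.ofReal_re] at main
  have hQ : MixedHessian.Qp m A B = ∑ k ∈ Finset.range (m + 1), Polynomial.C (c k : ℂ) * Polynomial.X ^ k := by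
    refine Polynomial.eq_of_infinite_eval_eq _ _ ?_
    refine Set.Infinite.mono (s := Set.range (fun t : ℝ => (t : ℂ))) ?_
      (Set.infinite_range_of_injective Complex.ofReal_injective)
    rintro _ ⟨t, rfl⟩
    show (MixedHessian.Qp m A B).eval (t : ℂ) = Polynomial.eval (t : ℂ) _
    rw [MixedHessian.Qp_eval, show A + (t : ℂ) • B = A + t • B from rfl,
      MixedHessian.Em_hermitian hmn (isHermitian_add_smul hA hB t), hc t, Polynomial.eval_finsetSum]
    push_cast
    simp
  rw [hQ, Polynomial.finsetSum_coeff] at main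
  simp only [Polynomial.coeff_C_mul, Polynomial.coeff_X_pow, mul_ite, mul_one, mul_zero] at main
  rw [Finset.sum_ite_eq, if_pos (by simpa [Nat.lt_succ_iff] using hk), Complex.ofReal_re] at main
  exact main
end

section
/- Mixed determinant (Alexandrov-type) coefficient inequality: let A and B be n×n positive semidefinite complex Hermitian matrices. The function t ↦ det(A + tB) is a real polynomial of degree at most n, say det(A + tB) = Σ_{j=0}^{n} c_j t^j. Then for every j = 0,…,n one has c_j ≥ C(n,j) · det(A)^{(n−j)/n} · det(B)^{j/n}, where C(n,j) is the binomial coefficient and real powers are taken with nonnegative base. -/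
open ComplexOrder

lemma aux_count_mem {n : ℕ} (hn : 1 ≤ n) (j : ℕ) (i : Fin n) :
    n * (((Finset.univ : Finset (Fin n)).powersetCard j).filter (fun s => i ∈ s)).card
      = j * n.choose j := by
  rcases j with _ | k
  · simp
  · have h := Finset.card_filter_powersetCard_subset {i} (Finset.univ : Finset (Fin n)) (k + 1)
      (by simp) (by simp)
    simp only [Finset.singleton_subset_iff, Finset.card_singleton, Finset.card_univ,
      Fintype.card_fin] at h
    rw [h]
    obtain ⟨m, rfl⟩ : ∃ m, n = m + 1 := ⟨n - 1, by omega⟩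
    have := Nat.add_one_mul_choose_eq m k
    simp only [Nat.add_sub_cancel]
    rw [this, mul_comm]

lemma aux_count_notMem {n : ℕ} (hn : 1 ≤ n) (j : ℕ) (hj : j ≤ n) (i : Fin n) :
    n * (((Finset.univ : Finset (Fin n)).powersetCard j).filter (fun s => i ∉ s)).card
      = (n - j) * n.choose j := by
  have h1 := aux_count_mem hn j i
  have h2 := Finset.card_filter_add_card_filter_not
    (s := (Finset.univ : Finset (Fin n)).powersetCard j) (fun s => i ∈ s)
  rw [Finset.card_powersetCard, Finset.card_univ, Fintype.card_fin] at h2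
  have h3 : n * n.choose j = j * n.choose j + (n - j) * n.choose j := by
    rw [← add_mul, Nat.add_sub_cancel' hj]
  rw [← h1] at h3
  conv_lhs at h3 => rw [← h2]
  rw [mul_add] at h3
  omega

/-- AM-GM for the mixed elementary symmetric functions. -/
lemma aux_amgm {n : ℕ} (hn : 1 ≤ n) (a b : Fin n → ℝ) (ha : ∀ i, 0 ≤ a i) (hb : ∀ i, 0 ≤ b i)
    (j : ℕ) (hj : j ≤ n) :
    (n.choose j : ℝ) * (∏ i, a i) ^ (((n - j : ℕ) : ℝ) / n) * (∏ i, b i) ^ ((j : ℝ) / n)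
      ≤ ∑ s ∈ (Finset.univ : Finset (Fin n)).powersetCard j,
        (∏ i ∈ s, b i) * ∏ i ∈ Finset.univ \ s, a i := by
  set P := (Finset.univ : Finset (Fin n)).powersetCard j with hP
  have hC : (0 : ℝ) < n.choose j := by exact_mod_cast Nat.choose_pos hj
  have hn0 : (n : ℝ) ≠ 0 := by positivity
  have hcard : P.card = n.choose j := by simp [hP]
  have key := Real.geom_mean_le_arith_mean_weighted P (fun _ => ((n.choose j : ℝ))⁻¹)
    (fun s => (∏ i ∈ s, b i) * ∏ i ∈ Finset.univ \ s, a i)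
    (fun _ _ => by positivity)
    (by rw [Finset.sum_const, hcard, nsmul_eq_mul, mul_inv_cancel₀ hC.ne'])
    (fun s _ => mul_nonneg (Finset.prod_nonneg fun i _ => hb i)
      (Finset.prod_nonneg fun i _ => ha i))
  rw [← Finset.mul_sum] at key
  have e1 : ∏ s ∈ P, ∏ i ∈ s, b i
      = ∏ i, b i ^ (P.filter (fun s => i ∈ s)).card := by
    rw [Finset.prod_comm' (t' := Finset.univ) (s' := fun i => P.filter (fun s => i ∈ s))]
    · simp
    · simp
  have e2 : ∏ s ∈ P, ∏ i ∈ Finset.univ \ s, a i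
      = ∏ i, a i ^ (P.filter (fun s => i ∉ s)).card := by
    rw [Finset.prod_comm' (t' := Finset.univ) (s' := fun i => P.filter (fun s => i ∉ s))]
    · simp
    · simp
  have e3 : (∏ s ∈ P, ∏ i ∈ s, b i) ^ ((n.choose j : ℝ))⁻¹ = (∏ i, b i) ^ ((j : ℝ) / n) := by
    rw [e1, ← Real.finsetProd_rpow _ _ (fun i _ => pow_nonneg (hb i) _),
      ← Real.finsetProd_rpow _ _ (fun i _ => hb i)]
    refine Finset.prod_congr rfl fun i _ => ?_
    rw [← Real.rpow_natCast, ← Real.rpow_mul (hb i)]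
    congr 1
    have := aux_count_mem hn j i
    have : (n : ℝ) * ((P.filter (fun s => i ∈ s)).card : ℝ) = j * n.choose j := by
      exact_mod_cast this
    field_simp
    linarith
  have e4 : (∏ s ∈ P, ∏ i ∈ Finset.univ \ s, a i) ^ ((n.choose j : ℝ))⁻¹
      = (∏ i, a i) ^ (((n - j : ℕ) : ℝ) / n) := by
    rw [e2, ← Real.finsetProd_rpow _ _ (fun i _ => pow_nonneg (ha i) _),
      ← Real.finsetProd_rpow _ _ (fun i _ => ha i)]
    refine Finset.prod_congr rfl fun i _ => ?_
    rw [← Real.rpow_natCast, ← Real.rpow_mul (ha i)]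
    congr 1
    have := aux_count_notMem hn j hj i
    have : (n : ℝ) * ((P.filter (fun s => i ∉ s)).card : ℝ) = ((n - j : ℕ) : ℝ) * n.choose j := by
      exact_mod_cast this
    field_simp
    linarith
  rw [Real.finsetProd_rpow _ _ (fun s _ => mul_nonneg (Finset.prod_nonneg fun i _ => hb i)
      (Finset.prod_nonneg fun i _ => ha i)), Finset.prod_mul_distrib,
    Real.mul_rpow (Finset.prod_nonneg fun s _ => Finset.prod_nonneg fun i _ => hb i)
      (Finset.prod_nonneg fun s _ => Finset.prod_nonneg fun i _ => ha i), e3, e4,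
    inv_mul_eq_div, le_div_iff₀ hC] at key
  linarith

/-- The coefficients of a polynomial function are determined by its values. -/
lemma aux_coeff_unique {n : ℕ} (c e : ℕ → ℝ)
    (h : ∀ t : ℝ, ∑ j ∈ Finset.range (n + 1), c j * t ^ j
      = ∑ j ∈ Finset.range (n + 1), e j * t ^ j) :
    ∀ j ≤ n, c j = e j := by
  intro j hj
  have hp : (∑ j ∈ Finset.range (n + 1), Polynomial.C (c j) * Polynomial.X ^ j)
      = ∑ j ∈ Finset.range (n + 1), Polynomial.C (e j) * Polynomial.X ^ j := by
    apply Polynomial.funext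
    intro t
    simpa [Polynomial.eval_finset_sum] using h t
  have := congrArg (fun p => Polynomial.coeff p j) hp
  simpa [Polynomial.finset_sum_coeff, Polynomial.coeff_C_mul, Polynomial.coeff_X_pow,
    Nat.lt_succ_iff, hj, Nat.not_lt.2 hj] using this

lemma aux_prod_expand {n : ℕ} (a b : Fin n → ℝ) (t : ℝ) :
    ∏ i, (a i + t * b i) = ∑ j ∈ Finset.range (n + 1),
      (∑ s ∈ (Finset.univ : Finset (Fin n)).powersetCard j,
        (∏ i ∈ s, b i) * ∏ i ∈ Finset.univ \ s, a i) * t ^ j := by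
  have h : ∀ i, a i + t * b i = t * b i + a i := fun i => add_comm _ _
  simp_rw [h]
  rw [Finset.prod_add, Finset.sum_powerset, Finset.card_univ, Fintype.card_fin]
  refine Finset.sum_congr rfl fun j _ => ?_
  rw [Finset.sum_mul]
  refine Finset.sum_congr rfl fun s hs => ?_
  rw [Finset.prod_mul_distrib, Finset.prod_const, (Finset.mem_powersetCard.1 hs).2]
  ring

/-- Simultaneous diagonalisation by congruence. -/
lemma aux_simul_diag {n : ℕ} (A B : Matrix (Fin n) (Fin n) ℂ) (hA : A.PosSemidef)
    (hB : B.PosSemidef) (hdet : (A + B).det ≠ 0) :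
    ∃ (T : Matrix (Fin n) (Fin n) ℂ) (a b : Fin n → ℝ), (∀ i, 0 ≤ a i) ∧ (∀ i, 0 ≤ b i) ∧
      A = T.conjTranspose * Matrix.diagonal (fun i => (a i : ℂ)) * T ∧
      B = T.conjTranspose * Matrix.diagonal (fun i => (b i : ℂ)) * T := by
  obtain ⟨S, hS⟩ : ∃ S : Matrix (Fin n) (Fin n) ℂ, A + B = S.conjTranspose * S := by
    open scoped MatrixOrder Matrix.Norms.L2Operator in
    exact CStarAlgebra.nonneg_iff_eq_star_mul_self.mp (hA.add hB).nonneg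
  have hSdet : IsUnit S.det := by
    rw [isUnit_iff_ne_zero]
    intro h
    apply hdet
    rw [hS, Matrix.det_mul, h, mul_zero]
  have hS1 : S * S⁻¹ = 1 := Matrix.mul_nonsing_inv _ hSdet
  have hS2 : S⁻¹ * S = 1 := Matrix.nonsing_inv_mul _ hSdet
  have hS3 : S.conjTranspose * (S⁻¹).conjTranspose = 1 := by
    rw [← Matrix.conjTranspose_mul, hS2, Matrix.conjTranspose_one]
  have hS4 : (S⁻¹).conjTranspose * S.conjTranspose = 1 := by
    rw [← Matrix.conjTranspose_mul, hS1, Matrix.conjTranspose_one]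
  set C := (S⁻¹).conjTranspose * A * S⁻¹ with hCdef
  have hC : C.PosSemidef := hA.conjTranspose_mul_mul_same _
  have hAC : A = S.conjTranspose * C * S := by
    calc A = (S.conjTranspose * (S⁻¹).conjTranspose) * A * (S⁻¹ * S) := by rw [hS3, hS2]; simp
      _ = _ := by rw [hCdef]; simp only [mul_assoc]
  obtain ⟨U, hU1, hU2, hU3⟩ : ∃ U : Matrix (Fin n) (Fin n) ℂ,
      U * U.conjTranspose = 1 ∧ U.conjTranspose * U = 1 ∧
      C = U * Matrix.diagonal (fun i => (hC.1.eigenvalues i : ℂ)) * U.conjTranspose := by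
    refine ⟨hC.1.eigenvectorUnitary, ?_, ?_, ?_⟩
    · exact Unitary.mul_star_self_of_mem hC.1.eigenvectorUnitary.2
    · exact Unitary.star_mul_self_of_mem hC.1.eigenvectorUnitary.2
    · have := hC.1.spectral_theorem
      rw [Unitary.conjStarAlgAut_apply] at this
      exact this
  set a := hC.1.eigenvalues with ha
  have hT : (U.conjTranspose * S).conjTranspose = S.conjTranspose * U := by
    rw [Matrix.conjTranspose_mul, Matrix.conjTranspose_conjTranspose]
  have hdiag : Matrix.diagonal (fun i => ((1 - a i : ℝ) : ℂ))
      = 1 - Matrix.diagonal (fun i => (a i : ℂ)) := by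
    rw [← Matrix.diagonal_one, Matrix.diagonal_sub]
    congr 1
    ext i
    simp
  have hA' : A = (U.conjTranspose * S).conjTranspose * Matrix.diagonal (fun i => (a i : ℂ))
      * (U.conjTranspose * S) := by
    rw [hT, hAC, hU3]; simp only [mul_assoc]
  have hB' : B = (U.conjTranspose * S).conjTranspose
      * Matrix.diagonal (fun i => ((1 - a i : ℝ) : ℂ)) * (U.conjTranspose * S) := by
    have : B = S.conjTranspose * S - A := by rw [← hS]; simp
    rw [this, hdiag, mul_sub, sub_mul, ← hA', hT, mul_one]
    congr 1
    calc S.conjTranspose * S = S.conjTranspose * (U * U.conjTranspose) * S := by rw [hU1]; simp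
      _ = _ := by simp only [mul_assoc]
  refine ⟨U.conjTranspose * S, a, fun i => 1 - a i, hC.eigenvalues_nonneg, ?_, hA', hB'⟩
  set T := U.conjTranspose * S with hTdef
  have hTR : T * (S⁻¹ * U) = 1 := by
    calc T * (S⁻¹ * U) = U.conjTranspose * (S * S⁻¹) * U := by rw [hTdef]; simp only [mul_assoc]
      _ = 1 := by rw [hS1, mul_one, hU2]
  have hTL : (S⁻¹ * U).conjTranspose * T.conjTranspose = 1 := by
    rw [← Matrix.conjTranspose_mul, hTR, Matrix.conjTranspose_one]
  have hD : (Matrix.diagonal (fun i => ((1 - a i : ℝ) : ℂ))).PosSemidef := by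
    have h := hB.conjTranspose_mul_mul_same (S⁻¹ * U)
    have e : (S⁻¹ * U).conjTranspose * B * (S⁻¹ * U)
        = Matrix.diagonal (fun i => ((1 - a i : ℝ) : ℂ)) := by
      calc _ = ((S⁻¹ * U).conjTranspose * T.conjTranspose)
            * Matrix.diagonal (fun i => ((1 - a i : ℝ) : ℂ)) * (T * (S⁻¹ * U)) := by
              rw [hB']; simp only [mul_assoc]
        _ = _ := by rw [hTL, hTR]; simp
    rwa [e] at h
  intro i
  have := (Matrix.posSemidef_diagonal_iff.1 hD) i
  exact_mod_cast this

/-- Mixed determinant (Alexandrov-type) coefficient inequality: let `A`, `B` be `n×n`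
positive semidefinite complex Hermitian matrices and suppose
`det(A + tB) = ∑_{j=0}^{n} c_j t^j` for all real `t` (with real coefficients `c_j`).
Then for every `j = 0,…,n` one has `c_j ≥ C(n,j) det(A)^{(n−j)/n} det(B)^{j/n}`,
real powers taken with nonnegative base. -/
theorem mixed_det_coefficient_inequality {n : ℕ} (hn : 1 ≤ n)
    (A B : Matrix (Fin n) (Fin n) ℂ) (hA : A.PosSemidef) (hB : B.PosSemidef)
    (c : ℕ → ℝ)
    (hc : ∀ t : ℝ, (A + t • B).det
        = ((∑ j ∈ Finset.range (n + 1), c j * t ^ j : ℝ) : ℂ)) :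
    ∀ j ≤ n, c j ≥ (n.choose j : ℝ)
        * A.det.re ^ (((n - j : ℕ) : ℝ) / n)
        * B.det.re ^ ((j : ℝ) / n) := by
  intro j hj
  have hn0 : (n : ℝ) ≠ 0 := by positivity
  by_cases hdet : (A + B).det = 0
  · -- a common kernel vector makes everything vanish
    obtain ⟨x, hx, hx0⟩ := Matrix.exists_mulVec_eq_zero_iff.2 hdet
    have h1 := hA.dotProduct_mulVec_nonneg x
    have h2 := hB.dotProduct_mulVec_nonneg x
    have h3 : star x ⬝ᵥ A.mulVec x + star x ⬝ᵥ B.mulVec x = 0 := by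
      rw [← dotProduct_add, ← Matrix.add_mulVec, hx0, dotProduct_zero]
    obtain ⟨h4, h5⟩ := (add_eq_zero_iff_of_nonneg h1 h2).1 h3
    have hAx := (hA.dotProduct_mulVec_zero_iff x).1 h4
    have hBx := (hB.dotProduct_mulVec_zero_iff x).1 h5
    have hA0 : A.det = 0 := Matrix.exists_mulVec_eq_zero_iff.1 ⟨x, hx, hAx⟩
    have hB0 : B.det = 0 := Matrix.exists_mulVec_eq_zero_iff.1 ⟨x, hx, hBx⟩
    have hc0 : c j = 0 := by
      refine aux_coeff_unique c (fun _ => 0) (fun t => ?_) j hj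
      have h6 : (A + t • B).det = 0 := Matrix.exists_mulVec_eq_zero_iff.1
        ⟨x, hx, by rw [Matrix.add_mulVec, Matrix.smul_mulVec, hAx, hBx]; simp⟩
      rw [hc t] at h6
      simpa using Complex.ofReal_eq_zero.1 h6
    rw [hc0, hA0, hB0, Complex.zero_re]
    rcases Nat.lt_or_ge j n with h | h
    · have : (((n - j : ℕ) : ℝ) / n) ≠ 0 := by
        apply div_ne_zero _ hn0
        exact_mod_cast (by omega : n - j ≠ 0)
      rw [Real.zero_rpow this]; simp
    · have : ((j : ℝ) / n) ≠ 0 := by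
        apply div_ne_zero _ hn0
        exact_mod_cast (by omega : j ≠ 0)
      rw [Real.zero_rpow this]; simp
  · obtain ⟨T, a, b, ha, hb, hA', hB'⟩ := aux_simul_diag A B hA hB hdet
    set d : ℝ := Complex.normSq T.det with hd
    have hd0 : 0 ≤ d := Complex.normSq_nonneg _
    have hgen : ∀ f : Fin n → ℝ,
        (T.conjTranspose * Matrix.diagonal (fun i => (f i : ℂ)) * T).det
          = ((d * ∏ i, f i : ℝ) : ℂ) := by
      intro f
      rw [Matrix.det_mul, Matrix.det_mul, Matrix.det_conjTranspose, Matrix.det_diagonal]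
      push_cast
      rw [hd, Complex.normSq_eq_conj_mul_self]
      simp only [RCLike.star_def]
      ring
    have hAd : A.det.re = d * ∏ i, a i := by rw [hA', hgen, Complex.ofReal_re]
    have hBd : B.det.re = d * ∏ i, b i := by rw [hB', hgen, Complex.ofReal_re]
    have hAB : ∀ t : ℝ, A + t • B
        = T.conjTranspose * Matrix.diagonal (fun i => ((a i + t * b i : ℝ) : ℂ)) * T := by
      intro t
      have : Matrix.diagonal (fun i => ((a i + t * b i : ℝ) : ℂ))
          = Matrix.diagonal (fun i => (a i : ℂ)) + t • Matrix.diagonal (fun i => (b i : ℂ)) := by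
        rw [← Matrix.diagonal_smul, Matrix.diagonal_add]
        congr 1
        ext i
        simp
      rw [this, mul_add, add_mul, ← hA', Matrix.mul_smul, Matrix.smul_mul, ← hB']
    have hcj := aux_coeff_unique c (fun j => d *
      ∑ s ∈ (Finset.univ : Finset (Fin n)).powersetCard j,
        (∏ i ∈ s, b i) * ∏ i ∈ Finset.univ \ s, a i) (fun t => by
        have h := hc t
        rw [hAB, hgen] at h
        rw [← Complex.ofReal_injective h, aux_prod_expand, Finset.mul_sum]
        exact Finset.sum_congr rfl fun _ _ => by ring) j hj
    rw [hcj, hAd, hBd, Real.mul_rpow hd0 (Finset.prod_nonneg fun i _ => ha i),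
      Real.mul_rpow hd0 (Finset.prod_nonneg fun i _ => hb i)]
    have hdd : d ^ (((n - j : ℕ) : ℝ) / n) * d ^ ((j : ℝ) / n) = d := by
      have hs : ((n - j : ℕ) : ℝ) / n + (j : ℝ) / n = 1 := by
        rw [← add_div, Nat.cast_sub hj, sub_add_cancel, div_self hn0]
      rw [← Real.rpow_add_of_nonneg hd0 (by positivity) (by positivity), hs, Real.rpow_one]
    have key := mul_le_mul_of_nonneg_left (aux_amgm hn a b ha hb j hj) hd0
    refine le_trans (le_of_eq ?_) key
    conv_rhs => rw [← hdd]
    ring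
end
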